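/- arXiv:math/0701836 — 3 statements merged into one kernel-verified Lean document; each statement's English description precedes it below -/
import Mathlib

section
/- For every N ≥ 1 and every n ≥ 1, the number of n-element subsets S ⊆ k̄^N \ {0} with σ(S) = S equals (q^N − 1) · (q^{nN} − (−1)^n) / (q^N + 1). -/
/-- The `q`-power Frobenius acting coordinatewise on `k̄^N`,
where `q = |k|`. -/
noncomputable def afFrob (k : Type*) [Field k] [Fintype k] (N : ℕ) :
    (Fin N → AlgebraicClosure k) → (Fin N → AlgebraicClosure k) :=
  fun v i => (v i) ^ (Fintype.card k)

/-- The number of `n`-element subsets `S` of `A ⊆ X` with `σ(S) = S`. -/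
noncomputable def nSetCount {X : Type*} (σ : X → X) (A : Set X) (n : ℕ) : ℕ :=
  Set.ncard {S : Set X | S ⊆ A ∧ S.Finite ∧ S.ncard = n ∧ σ '' S = S}

set_option linter.unusedSectionVars false
set_option linter.style.haveILetI false
open Finset PowerSeries
section Core
variable {Y : Type*} [Fintype Y] [DecidableEq Y]

/-- invariant finsets of card n -/
def invS (σ : Equiv.Perm Y) (n : ℕ) : Finset (Finset Y) :=
  univ.filter fun S => S.card = n ∧ ∀ y, σ y ∈ S ↔ y ∈ S

def eX (σ : Equiv.Perm Y) (x : Y) (n : ℕ) : ℕ := #((invS σ n).filter fun S => x ∈ S)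

theorem inv_iter (σ : Equiv.Perm Y) (S : Finset Y) (hS : ∀ y, σ y ∈ S ↔ y ∈ S) (x : Y) (i : ℕ) :
    σ^[i] x ∈ S ↔ x ∈ S := by
  induction i with
  | zero => simp
  | succ i ih => rw [Function.iterate_succ_apply', hS, ih]

noncomputable def orb (σ : Equiv.Perm Y) (x : Y) : Finset Y :=
  (range (Function.minimalPeriod σ x)).image fun i => σ^[i] x

theorem mper_pos (σ : Equiv.Perm Y) (x : Y) : 0 < Function.minimalPeriod σ x :=
  Function.minimalPeriod_pos_of_mem_periodicPts (Function.Injective.mem_periodicPts σ.injective x)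

theorem mem_orb (σ : Equiv.Perm Y) (x y : Y) : y ∈ orb σ x ↔ ∃ i : ℕ, σ^[i] x = y := by
  simp only [orb, mem_image, mem_range]
  constructor
  · rintro ⟨i, _, h⟩; exact ⟨i, h⟩
  · rintro ⟨i, h⟩
    exact ⟨i % Function.minimalPeriod σ x, Nat.mod_lt _ (mper_pos σ x), by
      rw [Function.iterate_mod_minimalPeriod_eq, h]⟩

theorem card_orb (σ : Equiv.Perm Y) (x : Y) : #(orb σ x) = Function.minimalPeriod σ x := by
  rw [orb, card_image_of_injOn, card_range]
  intro i hi j hj h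
  simp only [coe_range, Set.mem_Iio] at hi hj
  exact (Function.iterate_eq_iterate_iff_of_lt_minimalPeriod hi hj).1 h

theorem self_mem_orb (σ : Equiv.Perm Y) (x : Y) : x ∈ orb σ x := (mem_orb σ x x).2 ⟨0, rfl⟩

theorem inv_orb (σ : Equiv.Perm Y) (x y : Y) : σ y ∈ orb σ x ↔ y ∈ orb σ x := by
  rw [mem_orb, mem_orb]
  constructor
  · rintro ⟨i, h⟩
    cases i with
    | succ i => exact ⟨i, σ.injective ((Function.iterate_succ_apply' σ i x).symm.trans h)⟩
    | zero =>
      refine ⟨Function.minimalPeriod σ x - 1, σ.injective ?_⟩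
      rw [← Function.iterate_succ_apply' σ, Nat.succ_eq_add_one, Nat.sub_add_cancel (mper_pos σ x),
        Function.iterate_minimalPeriod]
      exact h
  · rintro ⟨i, h⟩; exact ⟨i + 1, by rw [Function.iterate_succ_apply', h]⟩

theorem orb_sub (σ : Equiv.Perm Y) (x : Y) (S : Finset Y) (hS : ∀ y, σ y ∈ S ↔ y ∈ S)
    (hx : x ∈ S) : orb σ x ⊆ S := by
  intro y hy
  obtain ⟨i, rfl⟩ := (mem_orb _ _ _).1 hy
  exact (inv_iter σ S hS x i).2 hx

theorem eX_lt (σ : Equiv.Perm Y) (x : Y) (n : ℕ) (h : n < Function.minimalPeriod σ x) :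
    eX σ x n = 0 := by
  rw [eX, card_eq_zero, filter_eq_empty_iff]
  intro S hS hx
  simp only [invS, mem_filter, mem_univ, true_and] at hS
  have := card_le_card (orb_sub σ x S hS.2 hx)
  rw [card_orb] at this; omega

theorem eX_add (σ : Equiv.Perm Y) (x : Y) (n : ℕ) :
    eX σ x (n + Function.minimalPeriod σ x) + eX σ x n = #(invS σ n) := by
  rw [← card_filter_add_card_filter_not (s := invS σ n) (fun S => x ∈ S), add_comm, eX, eX]
  congr 1
  refine card_nbij' (fun S => S \ orb σ x) (fun S => S ∪ orb σ x) ?_ ?_ ?_ ?_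
  · intro S hS
    simp only [invS, coe_filter, mem_filter, mem_univ, true_and, Set.mem_ofPred_eq] at hS ⊢
    obtain ⟨⟨h1, h2⟩, h3⟩ := hS
    refine ⟨⟨?_, ?_⟩, ?_⟩
    · rw [card_sdiff_of_subset (orb_sub σ x S h2 h3), card_orb, h1]; omega
    · intro y; rw [mem_sdiff, mem_sdiff, h2, inv_orb]
    · simp [self_mem_orb]
  · intro S hS
    simp only [invS, coe_filter, mem_filter, mem_univ, true_and, Set.mem_ofPred_eq] at hS ⊢
    obtain ⟨⟨h1, h2⟩, h3⟩ := hS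
    refine ⟨⟨?_, ?_⟩, ?_⟩
    · rw [card_union_of_disjoint, card_orb, h1]
      rw [Finset.disjoint_right]
      intro y hy hyS
      obtain ⟨i, rfl⟩ := (mem_orb _ _ _).1 hy
      exact h3 ((inv_iter σ S h2 x i).1 hyS)
    · intro y; rw [mem_union, mem_union, h2, inv_orb]
    · simp [self_mem_orb]
  · intro S hS
    simp only [invS, coe_filter, mem_filter, mem_univ, true_and, Set.mem_ofPred_eq] at hS ⊢
    obtain ⟨⟨h1, h2⟩, h3⟩ := hS
    exact sdiff_union_of_subset (orb_sub σ x S h2 h3)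
  · intro S hS
    simp only [invS, coe_filter, mem_filter, mem_univ, true_and, Set.mem_ofPred_eq] at hS ⊢
    obtain ⟨⟨h1, h2⟩, h3⟩ := hS
    rw [union_sdiff_right, Finset.sdiff_eq_self_iff_disjoint, Finset.disjoint_right]
    intro y hy hyS
    obtain ⟨i, rfl⟩ := (mem_orb _ _ _).1 hy
    exact h3 ((inv_iter σ S h2 x i).1 hyS)

noncomputable def wS (d : ℕ) : PowerSeries ℚ :=
  PowerSeries.mk fun m => if d ∣ m ∧ 0 < m then (-1) ^ (m / d + 1) else 0

theorem wS_mul (d : ℕ) (hd : 0 < d) : wS d * (1 + X ^ d) = X ^ d := by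
  ext m
  rw [mul_add, mul_one, map_add, coeff_mul_X_pow', coeff_X_pow, wS, coeff_mk]
  split_ifs with h1 h2 h3 h3 h3 h3 h4
  all_goals try simp only [coeff_mk]
  · subst h3; simp [Nat.div_self hd]
  · obtain ⟨⟨c, rfl⟩, h⟩ := h1
    have : d * c - d = d * (c - 1) := by rw [Nat.mul_sub, mul_one]
    have hc : c ≠ 0 := by rintro rfl; simp at h
    have hc : c ≠ 1 := by rintro rfl; simp at h3
    obtain ⟨c, rfl⟩ : ∃ e, c = e + 2 := ⟨c - 2, by omega⟩
    rw [this, Nat.mul_div_cancel_left _ hd, Nat.mul_div_cancel_left _ hd, if_pos]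
    · simp [pow_succ]
    · exact ⟨dvd_mul_right _ _, by simp [hd]⟩
  · omega
  · exact absurd (Nat.le_of_dvd h1.2 h1.1) h2
  · subst h3; exact absurd ⟨dvd_rfl, hd⟩ h1
  · rename_i h4
    rw [if_neg, zero_add]
    rintro ⟨h, h'⟩
    exact h1 ⟨(Nat.dvd_sub_iff_left h4 dvd_rfl).1 h, by omega⟩
  · omega
  · simp

theorem eX_series (σ : Equiv.Perm Y) (x : Y) :
    (PowerSeries.mk fun n => (eX σ x n : ℚ)) =
      wS (Function.minimalPeriod σ x) * PowerSeries.mk fun n => (#(invS σ n) : ℚ) := by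
  set d := Function.minimalPeriod σ x with hd
  have hd0 : 0 < d := mper_pos σ x
  have hne : (1 + X ^ d : PowerSeries ℚ) ≠ 0 := by
    intro h
    have := congrArg (PowerSeries.coeff 0) h
    simp [coeff_X_pow, hd0.ne, hd0.ne'] at this
  apply mul_right_cancel₀ hne
  rw [mul_right_comm, wS_mul d hd0]
  ext m
  rw [mul_add, mul_one, map_add, coeff_mul_X_pow', coeff_X_pow_mul']
  split_ifs with h
  · simp only [coeff_mk]
    have := eX_add σ x (m - d)
    rw [← hd, Nat.sub_add_cancel h] at this
    exact_mod_cast this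
  · simp only [coeff_mk]
    rw [eX_lt σ x m (by omega)]; simp

theorem sum_eX (σ : Equiv.Perm Y) (n : ℕ) : ∑ x, eX σ x n = n * #(invS σ n) := by
  simp only [eX, card_filter]
  rw [sum_comm]
  rw [sum_congr rfl (g := fun _ => n), sum_const, smul_eq_mul, mul_comm]
  intro S hS
  simp only [invS, mem_filter, mem_univ, true_and] at hS
  simp [hS.1]

noncomputable def pF (σ : Equiv.Perm Y) (m : ℕ) : ℕ := #(univ.filter fun x => σ^[m] x = x)

theorem core (σ : Equiv.Perm Y) (c : ℕ → ℚ) (hc0 : c 0 = 0)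
    (hc : ∀ m, 0 < m → c m = pF σ m - 2 * if 2 ∣ m then (pF σ (m / 2) : ℚ) else 0) (n : ℕ) :
    (n * #(invS σ n) : ℚ) = ∑ ij ∈ antidiagonal n, c ij.1 * #(invS σ ij.2) := by
  have h1 : (n * #(invS σ n) : ℚ) = ∑ x, (eX σ x n : ℚ) := by
    exact_mod_cast (sum_eX σ n).symm
  have h2 : ∀ x, (eX σ x n : ℚ) = ∑ ij ∈ antidiagonal n,
      coeff ij.1 (wS (Function.minimalPeriod σ x)) * #(invS σ ij.2) := by
    intro x
    have := congrArg (PowerSeries.coeff n) (eX_series σ x)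
    rw [coeff_mul] at this
    simpa only [coeff_mk] using this
  rw [h1, sum_congr rfl (fun x _ => h2 x), sum_comm]
  refine sum_congr rfl fun ij _ => ?_
  rw [← sum_mul]
  congr 1
  generalize ij.1 = m
  simp only [wS, coeff_mk]
  rcases Nat.eq_zero_or_pos m with rfl | hm
  · simp [hc0]
  rw [hc m hm]
  have h3 : ∀ x, (if Function.minimalPeriod σ x ∣ m ∧ 0 < m then
      ((-1) ^ (m / Function.minimalPeriod σ x + 1) : ℚ) else 0) =
      (if σ^[m] x = x then 1 else 0) - 2 * if 2 ∣ m then (if σ^[m/2] x = x then 1 else 0) else 0 := by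
    intro x
    have hp : ∀ j, σ^[j] x = x ↔ Function.minimalPeriod σ x ∣ j := fun j =>
      (Function.isPeriodicPt_iff_minimalPeriod_dvd (f := σ) (x := x) (n := j))
    simp only [hp]
    have hd := mper_pos σ x
    generalize Function.minimalPeriod σ x = d at hd
    by_cases h : d ∣ m
    · obtain ⟨e, rfl⟩ := h
      simp only [dvd_mul_right, hm, and_self, if_true, Nat.mul_div_cancel_left _ hd]
      rcases Nat.even_or_odd' e with ⟨f, rfl | rfl⟩
      · have : d * (2 * f) = 2 * (d * f) := by ring
        rw [this, if_pos (dvd_mul_right _ _), Nat.mul_div_cancel_left _ two_pos,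
          if_pos (dvd_mul_right _ _)]
        norm_num [pow_succ, pow_mul]
      · have : ¬ (2 ∣ d * (2 * f + 1) ∧ d ∣ d * (2 * f + 1) / 2) := by
          rintro ⟨h2, g, hg⟩
          have : d * (2 * f + 1) = d * (2 * g) := by
            rw [← Nat.mul_div_cancel' h2, hg]; ring
          have := Nat.eq_of_mul_eq_mul_left hd this
          omega
        rw [← ite_and, if_neg this]
        norm_num [pow_succ, pow_mul]
    · have : ¬ (2 ∣ m ∧ d ∣ m / 2) := by
        rintro ⟨h2, h3⟩
        exact h (h3.trans (Nat.div_dvd_of_dvd h2))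
      rw [← ite_and, if_neg this]
      simp [h]
  rw [sum_congr rfl (fun x _ => h3 x), sum_sub_distrib, ← mul_sum]
  simp only [pF, card_filter]
  split_ifs <;> simp
end Core

section Alg

noncomputable def cQ (Q : ℚ) (m : ℕ) : ℚ := Q ^ m + (-1) ^ m - 2 * if 2 ∣ m then Q ^ (m / 2) else 0

noncomputable def fQ (Q : ℚ) (n : ℕ) : ℚ :=
  if n = 0 then 1 else (Q - 1) * (Q ^ n - (-1) ^ n) / (Q + 1)

theorem geo (a : ℚ) : (PowerSeries.mk fun n => a ^ n) * (1 - C a * X) = 1 := by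
  ext m
  cases m with
  | zero => simp
  | succ m =>
    rw [mul_sub, mul_one, map_sub, ← mul_assoc, coeff_succ_mul_X, coeff_mul_C]
    simp [pow_succ]

theorem geo2 (a : ℚ) : (PowerSeries.mk fun n => if 2 ∣ n then a ^ (n/2) else 0) *
    (1 - C a * X ^ 2) = 1 := by
  ext m
  rw [mul_sub, mul_one, map_sub, ← mul_assoc, coeff_mul_X_pow']
  rcases m with _ | _ | m
  · simp
  · simp
  · have h1 : (2 ∣ m + 1 + 1) ↔ 2 ∣ m := by omega
    have h2 : (m + 1 + 1) / 2 = m / 2 + 1 := by omega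
    rw [coeff_mul_C]
    simp only [coeff_mk, h1, h2]
    simp [pow_succ]

theorem key (Q : ℚ) (hQ : 1 ≤ Q) (n : ℕ) :
    n * fQ Q n = ∑ ij ∈ antidiagonal n, cQ Q ij.1 * fQ Q ij.2 := by
  set F := PowerSeries.mk (fQ Q)
  set G := PowerSeries.mk (cQ Q)
  set A := PowerSeries.mk fun n => Q ^ n
  set B := PowerSeries.mk fun n => (-1 : ℚ) ^ n
  set D := PowerSeries.mk fun n => if 2 ∣ n then Q ^ (n/2) else 0
  have hA : A * (1 - C Q * X) = 1 := geo Q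
  have hB : B * (1 + X) = 1 := by simpa using geo (-1)
  have hD : D * (1 - C Q * X ^ 2) = 1 := geo2 Q
  have hG : G = A + B - 2 * D := by
    ext m
    rw [two_mul, map_sub, map_add, map_add]
    simp only [G, A, B, D, cQ, coeff_mk]
    ring
  have hF : C (Q + 1) * F = C (Q + 1) + C (Q - 1) * (A - B) := by
    ext m
    rw [(coeff m).map_add, coeff_C_mul, coeff_C_mul, map_sub (coeff m) A B]
    have : Q + 1 ≠ 0 := by positivity
    simp only [F, A, B, coeff_mk, fQ, coeff_C]
    split_ifs with h
    · subst h; simp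
    · field_simp; ring
  have hq : (C (Q+1) : PowerSeries ℚ) = C Q + 1 := by simp
  have hq' : (C (Q-1) : PowerSeries ℚ) = C Q - 1 := by simp
  have hq0 : (C Q + 1 : PowerSeries ℚ) ≠ 0 := by
    rw [← hq]
    intro h
    have := congrArg (PowerSeries.coeff 0) h
    simp at this; linarith
  rw [hq, hq'] at hF
  have hFR : F * ((1 - C Q * X) * (1 + X)) = 1 - C Q * X ^ 2 := by
    apply mul_left_cancel₀ hq0
    linear_combination ((1 - C Q * X) * (1 + X)) * hF + (C Q - 1) * (1 + X) * hA - (C Q - 1) * (1 - C Q * X) * hB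
  have hd := congrArg (PowerSeries.derivative ℚ) hFR
  have hdd : F * ((1 - C Q * X) - C Q * (1 + X)) + (PowerSeries.derivative ℚ F) * ((1 - C Q * X) * (1 + X)) = - C Q * (2 * X) := by
    have e1 : PowerSeries.derivative ℚ (C Q) = 0 := PowerSeries.derivative_C
    have e2 : PowerSeries.derivative ℚ (1 : PowerSeries ℚ) = 0 := PowerSeries.derivative_one
    have e3 : PowerSeries.derivative ℚ (X : PowerSeries ℚ) = 1 := PowerSeries.derivative_X
    simp only [Derivation.leibniz, map_sub, map_add, e1, e2, e3, smul_eq_mul, pow_two] at hd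
    linear_combination hd
  set R : PowerSeries ℚ := (1 - C Q * X) * (1 + X) with hR
  set P : PowerSeries ℚ := 1 - C Q * X ^ 2 with hP
  have hRne : R ≠ 0 := by
    rintro h; rw [h] at hR
    have := congrArg (PowerSeries.coeff 0) hR
    simp at this
  have hPne : P ≠ 0 := by
    rintro h; rw [h, mul_zero] at hD; exact zero_ne_one hD
  have hGR : G * (R * P) = ((1 + X) * P + (1 - C Q * X) * P - 2 * R) := by
    rw [hG]
    linear_combination (1 + X) * P * hA + (1 - C Q * X) * P * hB - 2 * R * hD
  have main : X * PowerSeries.derivative ℚ F = G * F := by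
    apply mul_right_cancel₀ (mul_ne_zero (mul_ne_zero hRne hRne) hPne)
    have t1 : X * PowerSeries.derivative ℚ F * (R * R * P) = X * P * (R * (- C Q * (2 * X)) - P * ((1 - C Q * X) - C Q * (1 + X))) := by
      linear_combination X * P * R * hdd - X * P * ((1 - C Q * X) - C Q * (1 + X)) * hFR
    have t2 : G * F * (R * R * P) = P * ((1 + X) * P + (1 - C Q * X) * P - 2 * R) := by
      linear_combination F * R * hGR + ((1 + X) * P + (1 - C Q * X) * P - 2 * R) * hFR
    rw [t1, t2, hR, hP]; ring
  have := congrArg (PowerSeries.coeff n) main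
  rw [coeff_mul n G F] at this
  simp only [G, F, coeff_mk] at this
  rw [← this]
  cases n with
  | zero => simp
  | succ n => rw [mul_comm X, coeff_succ_mul_X, PowerSeries.coeff_derivative]; simp [mul_comm]

theorem uniq (Q : ℚ) (hQ : 1 ≤ Q) (s c : ℕ → ℚ) (M : ℕ) (hs0 : s 0 = 1)
    (hc : ∀ m ≤ M, c m = cQ Q m)
    (hs : ∀ n, n * s n = ∑ ij ∈ antidiagonal n, c ij.1 * s ij.2) (n : ℕ) (hn : n ≤ M) :
    s n = fQ Q n := by
  induction n using Nat.strong_induction_on with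
  | _ n ih =>
  rcases Nat.eq_zero_or_pos n with rfl | h0
  · simp [hs0, fQ]
  have : (n : ℚ) ≠ 0 := by positivity
  apply mul_left_cancel₀ this
  rw [hs, key Q hQ]
  refine sum_congr rfl fun ij hij => ?_
  rw [HasAntidiagonal.mem_antidiagonal] at hij
  rw [hc _ (by omega)]
  rcases Nat.eq_zero_or_pos ij.1 with h | h
  · rw [h]; norm_num [cQ]
  · rw [ih ij.2 (by omega) (by omega)]
end Alg

theorem core2 {Y : Type*} [Fintype Y] [DecidableEq Y] (σ : Equiv.Perm Y) (Q n : ℕ) (hn : 1 ≤ n)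
    (hQ : 1 ≤ Q) (hp : ∀ m, 0 < m → m ≤ n → pF σ m + 1 = Q ^ m) :
    (#(invS σ n) : ℚ) = ((Q : ℚ) - 1) * ((Q : ℚ) ^ n - (-1) ^ n) / ((Q : ℚ) + 1) := by
  have hp' : ∀ m, 0 < m → m ≤ n → (pF σ m : ℚ) = (Q : ℚ) ^ m - 1 := by
    intro m h h'
    rw [eq_sub_iff_add_eq]; exact_mod_cast hp m h h'
  have := uniq (Q : ℚ) (by exact_mod_cast hQ) (fun n => #(invS σ n))
    (fun m => if m = 0 then 0 else pF σ m - 2 * if 2 ∣ m then (pF σ (m / 2) : ℚ) else 0) n ?_ ?_ ?_ n le_rfl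
  · rw [this, fQ, if_neg (by omega)]
  · have : invS σ 0 = {∅} := by
      ext S
      simp only [invS, mem_filter, mem_univ, true_and, card_eq_zero, mem_singleton]
      constructor
      · exact fun h => h.1
      · rintro rfl; simp
    simp [this]
  · intro m hm
    split_ifs with h h2
    · subst h; norm_num [cQ]
    · rw [hp' m (by omega) hm, hp' (m/2) (by omega) (by omega), cQ, if_pos h2]
      rw [Even.neg_one_pow (even_iff_two_dvd.2 h2)]; ring
    · rw [hp' m (by omega) hm, cQ, if_neg h2]
      rw [Odd.neg_one_pow (by rw [← Nat.not_even_iff_odd, even_iff_two_dvd]; exact h2)]; ring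
  · intro n
    refine core σ (fun m => if m = 0 then 0 else
      pF σ m - 2 * if 2 ∣ m then (pF σ (m / 2) : ℚ) else 0) (if_pos rfl) ?_ n
    intro m hm
    exact if_neg hm.ne'

theorem afFrob_iter (k : Type*) [Field k] [Fintype k] (N m : ℕ) (v : Fin N → AlgebraicClosure k) :
    (afFrob k N)^[m] v = fun i => v i ^ (Fintype.card k) ^ m := by
  induction m with
  | zero => simp
  | succ m ih =>
    rw [Function.iterate_succ_apply', ih]
    funext i
    simp [afFrob, ← pow_mul, pow_succ]

theorem card_fix1 (k : Type*) [Field k] [Fintype k] (m : ℕ) (hm : 0 < m) :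
    Nat.card {x : AlgebraicClosure k // x ^ (Fintype.card k) ^ m = x} = (Fintype.card k) ^ m := by
  classical
  obtain ⟨p, hp⟩ := CharP.exists k
  haveI : CharP (AlgebraicClosure k) p := charP_of_injective_algebraMap (algebraMap k _).injective p
  have hdvd : p ∣ Fintype.card k := by
    rw [← CharP.cast_eq_zero_iff k p]; exact Nat.cast_card_eq_zero k
  have hsep := galois_poly_separable (K := AlgebraicClosure k) p ((Fintype.card k) ^ m)
    (dvd_pow hdvd hm.ne')
  have h1 : 1 < Fintype.card k := Fintype.one_lt_card
  have := Polynomial.card_rootSet_eq_natDegree (K := AlgebraicClosure k) hsep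
    (IsAlgClosed.splits _)
  rw [FiniteField.X_pow_card_pow_sub_X_natDegree_eq _ hm.ne' h1, ← Nat.card_eq_fintype_card] at this
  refine (Nat.card_congr (Equiv.subtypeEquivRight fun x => ?_)).trans this
  rw [Polynomial.mem_rootSet]
  simp [FiniteField.X_pow_card_pow_sub_X_ne_zero _ hm.ne' h1, sub_eq_zero]

theorem finite_fix1 (k : Type*) [Field k] [Fintype k] (m : ℕ) (hm : 0 < m) :
    Finite {x : AlgebraicClosure k // x ^ (Fintype.card k) ^ m = x} := by
  apply Nat.finite_of_card_ne_zero
  rw [card_fix1 k m hm]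
  exact pow_ne_zero _ Fintype.card_ne_zero

def fixEquiv (k : Type*) [Field k] [Fintype k] (N m : ℕ) :
    {v : Fin N → AlgebraicClosure k // (afFrob k N)^[m] v = v} ≃
      (Fin N → {x : AlgebraicClosure k // x ^ (Fintype.card k) ^ m = x}) where
  toFun v i := ⟨v.1 i, by have := congrFun v.2 i; rwa [afFrob_iter] at this⟩
  invFun w := ⟨fun i => (w i).1, by rw [afFrob_iter]; funext i; exact (w i).2⟩
  left_inv _ := rfl
  right_inv _ := rfl

theorem finite_fix (k : Type*) [Field k] [Fintype k] (N m : ℕ) (hm : 0 < m) :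
    Finite {v : Fin N → AlgebraicClosure k // (afFrob k N)^[m] v = v} := by
  haveI := finite_fix1 k m hm
  exact Finite.of_equiv _ (fixEquiv k N m).symm

theorem card_fix (k : Type*) [Field k] [Fintype k] (N m : ℕ) (hm : 0 < m) :
    Nat.card {v : Fin N → AlgebraicClosure k // (afFrob k N)^[m] v = v} =
      ((Fintype.card k) ^ N) ^ m := by
  rw [Nat.card_congr (fixEquiv k N m), Nat.card_fun, card_fix1 k m hm]
  simp [← pow_mul, mul_comm]

theorem afFrob_inj (k : Type*) [Field k] [Fintype k] (N : ℕ) : Function.Injective (afFrob k N) := by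
  obtain ⟨p, hp⟩ := CharP.exists k
  haveI : CharP (AlgebraicClosure k) p := charP_of_injective_algebraMap (algebraMap k _).injective p
  obtain ⟨n, hpp, hc⟩ := FiniteField.card k p
  haveI : Fact p.Prime := ⟨hpp⟩
  intro v w h
  funext i
  have := congrFun h i
  simp only [afFrob, hc] at this
  exact iterateFrobenius_inj (AlgebraicClosure k) p n this

theorem afFrob_zero (k : Type*) [Field k] [Fintype k] (N : ℕ) : afFrob k N 0 = 0 := by
  funext i; simp [afFrob]

/-- transfer to a finite type -/
theorem transfer {X : Type*} (f : X → X) (hf : Function.Injective f) (x0 : X) (h0 : f x0 = x0)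
    (n : ℕ) (Q : ℕ) (hn : 1 ≤ n) (hQ : 1 ≤ Q) (hfin : Finite {v : X // f^[n.factorial] v = v})
    (hfin' : ∀ m, 0 < m → Finite {v : X // f^[m] v = v})
    (hcard : ∀ m, 0 < m → Nat.card {v : X // f^[m] v = v} = Q ^ m) :
    (nSetCount f {v | v ≠ x0} n : ℚ) =
      ((Q : ℚ) - 1) * ((Q : ℚ) ^ n - (-1) ^ n) / ((Q : ℚ) + 1) := by
  classical
  let Y := {v : X // v ≠ x0 ∧ f^[n.factorial] v = v}
  haveI : Finite Y := Finite.of_injective (β := {v : X // f^[n.factorial] v = v})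
    (fun y => ⟨y.1, y.2.2⟩) (fun a b h => Subtype.ext (Subtype.mk.inj h))
  letI : Fintype Y := Fintype.ofFinite Y
  let g : Y → Y := fun y => ⟨f y.1, fun h => y.2.1 (hf (h.trans h0.symm)), by
    rw [← Function.iterate_succ_apply, Function.iterate_succ_apply', y.2.2]⟩
  have hg : Function.Injective g := fun a b h => Subtype.ext (hf (congrArg Subtype.val h))
  let σ : Equiv.Perm Y := Equiv.ofBijective g (Finite.injective_iff_bijective.1 hg)
  have hσ : ∀ y, (σ y).1 = f y.1 := fun y => rfl
  have hσm : ∀ m y, (σ^[m] y).1 = f^[m] y.1 := by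
    intro m y
    induction m with
    | zero => rfl
    | succ m ih => rw [Function.iterate_succ_apply', Function.iterate_succ_apply', hσ, ih]
  have hfx0 : ∀ m, f^[m] x0 = x0 := fun m => Function.iterate_fixed h0 m
  have hp : ∀ m, 0 < m → m ≤ n → pF σ m + 1 = Q ^ m := by
    intro m hm hmn
    haveI := hfin' m hm
    rw [← hcard m hm]
    have hper : ∀ v, f^[m] v = v → f^[n.factorial] v = v := fun v hv =>
      Function.IsPeriodicPt.trans_dvd (f := f) (x := v) (m := m) hv (Nat.dvd_factorial hm hmn)
    have e : Option {y : Y // σ^[m] y = y} ≃ {v : X // f^[m] v = v} :=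
      Equiv.ofBijective (fun o => match o with
        | none => ⟨x0, hfx0 m⟩
        | some y => ⟨y.1.1, by rw [← hσm, y.2]⟩) (by
      constructor
      · rintro (_ | a) (_ | b) h
        · rfl
        · exact absurd (congrArg Subtype.val h).symm b.1.2.1
        · exact absurd (congrArg Subtype.val h) a.1.2.1
        · exact congrArg some (Subtype.ext (Subtype.ext (Subtype.mk.inj h)))
      · rintro ⟨v, hv⟩
        by_cases h : v = x0
        · exact ⟨none, Subtype.ext h.symm⟩
        · exact ⟨some ⟨⟨v, h, hper v hv⟩, Subtype.ext ((hσm m _).trans hv)⟩, rfl⟩)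
    rw [← Nat.card_congr e, Finite.card_option, pF, Nat.card_eq_fintype_card, Fintype.card_subtype]
  rw [← core2 σ Q n hn hQ hp]
  congr 1
  rw [nSetCount, ← Set.ncard_coe_finset]
  symm
  refine Set.ncard_congr (fun S _ => Subtype.val '' (S : Set Y)) ?_ ?_ ?_
  · intro S hS
    simp only [invS, coe_filter, mem_univ, true_and, Set.mem_ofPred_eq] at hS
    refine ⟨?_, S.finite_toSet.image _, ?_, ?_⟩
    · rintro _ ⟨y, _, rfl⟩; exact y.2.1
    · rw [Set.ncard_image_of_injective _ Subtype.val_injective, Set.ncard_coe_finset, hS.1]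
    · ext v
      constructor
      · rintro ⟨_, ⟨y, hy, rfl⟩, rfl⟩
        exact ⟨σ y, (hS.2 y).2 hy, rfl⟩
      · rintro ⟨y, hy, rfl⟩
        refine ⟨(σ.symm y).1, ⟨σ.symm y, (hS.2 _).1 (by simpa using hy), rfl⟩, ?_⟩
        rw [← hσ, Equiv.apply_symm_apply]
  · intro S T _ _ h
    exact_mod_cast Set.image_injective.2 Subtype.val_injective h
  · rintro T ⟨hT1, hT2, hT3, hT4⟩
    have hmem : ∀ v ∈ T, f v ∈ T := fun v hv => hT4 ▸ Set.mem_image_of_mem f hv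
    have hper : ∀ v ∈ T, f^[n.factorial] v = v := by
      haveI : Finite T := hT2
      letI : Fintype T := Fintype.ofFinite T
      let τ : Equiv.Perm T := Equiv.ofBijective (fun v => ⟨f v.1, hmem v.1 v.2⟩ : T → T)
        (Finite.injective_iff_bijective.1 fun a b h => Subtype.ext (hf (congrArg Subtype.val h)))
      have hτm : ∀ m y, ((τ ^ m) y).1 = f^[m] y.1 := by
        intro m y
        induction m with
        | zero => rfl
        | succ m ih => rw [pow_succ', Function.iterate_succ_apply', ← ih]; rfl
      intro v hv
      have h1 : τ ^ n.factorial = 1 := by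
        have := pow_card_eq_one (x := τ)
        rwa [Fintype.card_perm, ← Nat.card_eq_fintype_card, Nat.card_coe_set_eq, hT3] at this
      rw [← hτm _ ⟨v, hv⟩, h1]; rfl
    have himg : Subtype.val '' ((univ.filter fun y : Y => y.1 ∈ T : Finset Y) : Set Y) = T := by
      ext v
      constructor
      · rintro ⟨y, hy, rfl⟩; exact (mem_filter.1 (mem_coe.1 hy)).2
      · intro hv; exact ⟨⟨v, hT1 hv, hper v hv⟩, mem_coe.2 (mem_filter.2 ⟨mem_univ _, hv⟩), rfl⟩
    refine ⟨univ.filter fun y : Y => y.1 ∈ T, ?_, himg⟩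
    simp only [invS, coe_filter, mem_univ, true_and, Set.mem_ofPred_eq, mem_filter]
    refine ⟨?_, ?_⟩
    · rw [← Set.ncard_coe_finset, ← Set.ncard_image_of_injective _ Subtype.val_injective, himg, hT3]
    · intro y
      rw [hσ]
      constructor
      · intro h
        rw [← hT4] at h
        obtain ⟨w, hw, h⟩ := h
        rwa [← hf h]
      · exact hmem _

/-- For `N ≥ 1` and `n ≥ 1`, the number of `n`-element subsets
`S ⊆ k̄^N \ {0}` with `σ(S) = S` equals
`(q^N − 1)(q^{nN} − (−1)^n)/(q^N + 1)`. -/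
theorem stmt2 (k : Type*) [Field k] [Fintype k] (q N n : ℕ)
    (hq : Fintype.card k = q) (hN : 1 ≤ N) (hn : 1 ≤ n) :
    (nSetCount (afFrob k N) {v : Fin N → AlgebraicClosure k | v ≠ 0} n : ℚ) =
      ((q : ℚ) ^ N - 1) * ((q : ℚ) ^ (n * N) - (-1) ^ n) / ((q : ℚ) ^ N + 1) := by
  subst hq
  have := transfer (afFrob k N) (afFrob_inj k N) 0 (afFrob_zero k N) n ((Fintype.card k) ^ N) hn
    (Nat.one_le_pow _ _ Fintype.card_pos) (finite_fix k N _ n.factorial_pos) (finite_fix k N)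
    (card_fix k N)
  rw [this]
  push_cast
  rw [← pow_mul, mul_comm N n]
end

section
/- Let a(n) be the number of n-element subsets S ⊆ ℙ¹(k̄) with σ(S) = S. Then a(1) = q + 1, a(2) = q², and a(n) = q^n − q^{n−2} for all n ≥ 3. -/
/-- The `q`-power Frobenius acting on `ℙ^{m-1}(k̄)` (raising homogeneous
coordinates to the `q`-th power), where `q = |k|`. -/
noncomputable def projFrob (k : Type*) [Field k] [Fintype k] (m : ℕ) :
    Projectivization (AlgebraicClosure k) (Fin m → AlgebraicClosure k) →
    Projectivization (AlgebraicClosure k) (Fin m → AlgebraicClosure k) :=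
  fun P => Projectivization.mk (AlgebraicClosure k)
    (fun i => (P.rep i) ^ (Fintype.card k)) (by
      intro h
      apply P.rep_nonzero
      funext i
      have hi : P.rep i ^ (Fintype.card k) = 0 := by simpa using congrFun h i
      simpa using pow_eq_zero_iff (Fintype.card_ne_zero (α := k)) |>.mp hi)

section counting
open Classical

/-- invariant multisets of size n -/
abbrev InvMS {K : Type*} (f : K → K) (n : ℕ) := {M : Multiset K // M.map f = M ∧ M.card = n}
/-- invariant nodup multisets of size n -/
abbrev InvND {K : Type*} (f : K → K) (n : ℕ) :=
  {M : Multiset K // (M.map f = M ∧ M.card = n) ∧ M.Nodup}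

theorem inv_iff {K : Type*} {f : K → K} (hf : f.Bijective) (M : Multiset K) :
    M.map f = M ↔ ∀ a, M.count (f a) = M.count a := by
  constructor
  · intro h a
    conv_lhs => rw [← h]
    exact Multiset.count_map_eq_count' f M hf.1 a
  · intro h
    ext b
    obtain ⟨a, rfl⟩ := hf.2 b
    rw [Multiset.count_map_eq_count' f M hf.1 a, h]

theorem invMS_bij {K : Type*} {f : K → K} (hf : f.Bijective) (n : ℕ) :
    ∃ F : (Σ j : Fin (n / 2 + 1), InvMS f j × InvND f (n - 2 * j)) → InvMS f n, F.Bijective := by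
  refine ⟨fun x => ⟨2 • x.2.1.1 + x.2.2.1, ?_, ?_⟩, ?_, ?_⟩
  · obtain ⟨j, N, T⟩ := x
    simp [Multiset.map_add, Multiset.map_nsmul, N.2.1, T.2.1.1]
  · obtain ⟨j, N, T⟩ := x
    have := j.2
    simp [N.2.2, T.2.1.2]
    omega
  · rintro ⟨j, ⟨N, hN⟩, ⟨T, hT⟩⟩ ⟨l, ⟨O, hO⟩, ⟨U, hU⟩⟩ h
    simp only [Subtype.mk.injEq] at h
    have hc : ∀ a, N.count a = O.count a ∧ T.count a = U.count a := by
      intro a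
      have := congrArg (Multiset.count a) h
      simp only [Multiset.count_add, Multiset.count_nsmul] at this
      have h1 := Multiset.nodup_iff_count_le_one.1 hT.2 a
      have h2 := Multiset.nodup_iff_count_le_one.1 hU.2 a
      omega
    obtain rfl : N = O := Multiset.ext.2 fun a => (hc a).1
    obtain rfl : T = U := Multiset.ext.2 fun a => (hc a).2
    obtain rfl : j = l := Fin.ext (hN.2.symm.trans hO.2)
    rfl
  · rintro ⟨M, hM, hMn⟩
    let N : Multiset K := Finsupp.toMultiset ((Multiset.toFinsupp M).mapRange (· / 2) rfl)
    let T : Multiset K := Finsupp.toMultiset ((Multiset.toFinsupp M).mapRange (· % 2) rfl)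
    have cN : ∀ a, N.count a = M.count a / 2 := by
      intro a; simp [N, Finsupp.count_toMultiset]
    have cT : ∀ a, T.count a = M.count a % 2 := by
      intro a; simp [T, Finsupp.count_toMultiset]
    have hS : 2 • N + T = M := by
      ext a
      simp only [Multiset.count_add, Multiset.count_nsmul, cN, cT]
      omega
    have hcard : 2 * N.card + T.card = n := by
      rw [← hMn, ← hS]; simp
    rw [inv_iff hf] at hM
    refine ⟨⟨⟨N.card, by omega⟩, ⟨N, ?_, rfl⟩, ⟨T, ⟨?_, ?_⟩, ?_⟩⟩, ?_⟩
    · rw [inv_iff hf]; intro a; rw [cN, cN, hM]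
    · rw [inv_iff hf]; intro a; rw [cT, cT, hM]
    · simp only; omega
    · rw [Multiset.nodup_iff_count_le_one]; intro a; rw [cT]; omega
    · exact Subtype.ext hS

theorem card_ND {K : Type*} {f : K → K} (hf : f.Bijective) (q : ℕ) [∀ n, Finite (InvMS f n)]
    (h : ∀ n, Nat.card (InvMS f n) = q ^ n) :
    Nat.card (InvND f 0) = 1 ∧ Nat.card (InvND f 1) = q ∧
    ∀ n, Nat.card (InvND f (n + 2)) + q ^ (n + 1) = q ^ (n + 2) := by
  have hfin : ∀ n, Finite (InvND f n) := fun n =>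
    Finite.of_injective (fun x : InvND f n => (⟨x.1, x.2.1⟩ : InvMS f n))
      (fun x y hxy => Subtype.ext (congrArg (fun z : InvMS f n => z.1) hxy))
  have key : ∀ n, q ^ n = ∑ j ∈ Finset.range (n / 2 + 1), q ^ j * Nat.card (InvND f (n - 2 * j)) := by
    intro n
    obtain ⟨F, hF⟩ := invMS_bij hf n
    have := Nat.card_eq_of_bijective F hF
    rw [h, Nat.card_sigma] at this
    rw [← this, Finset.sum_range]
    simp [Nat.card_prod, h]
  refine ⟨?_, ?_, ?_⟩
  · have := key 0; simpa using this.symm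
  · have := key 1; simpa using this.symm
  · intro n
    have h2 := key (n + 2)
    rw [show (n + 2) / 2 + 1 = n / 2 + 1 + 1 by omega, Finset.sum_range_succ'] at h2
    have : ∑ j ∈ Finset.range (n / 2 + 1), q ^ (j + 1) * Nat.card (InvND f (n + 2 - 2 * (j + 1)))
      = q ^ (n + 1) := by
      rw [pow_succ, key n, Finset.sum_mul]
      refine Finset.sum_congr rfl fun j _ => ?_
      rw [show n + 2 - 2 * (j + 1) = n - 2 * j by omega]
      ring
    rw [this] at h2
    simp at h2
    omega

/-- Invariant finite sets versus nodup multisets. -/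
theorem bij_sets {K : Type*} (f : K → K) (hf : f.Bijective) (n : ℕ) :
    ∃ F : InvND f n → {S : Set K | S.Finite ∧ S.ncard = n ∧ f '' S = S}, F.Bijective := by
  refine ⟨fun x : InvND f n => ⟨{a | a ∈ x.1}, ?_, ?_, ?_⟩, ?_, ?_⟩
  · exact (x.1.toFinset.finite_toSet).subset (by intro a; simp)
  · have : {a | a ∈ x.1} = (x.1.toFinset : Set K) := by ext; simp
    rw [this, Set.ncard_coe_finset, Multiset.toFinset_card_of_nodup x.2.2, x.2.1.2]
  · ext a
    conv_rhs => rw [← x.2.1.1]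
    simp
  · rintro ⟨M, hM⟩ ⟨L, hL⟩ h
    simp only [Subtype.mk.injEq] at h
    apply Subtype.ext
    exact (Multiset.Nodup.ext hM.2 hL.2).2 fun a => Set.ext_iff.1 h a
  · rintro ⟨S, hS, hn, hi⟩
    refine ⟨⟨hS.toFinset.val, ⟨?_, ?_⟩, hS.toFinset.nodup⟩, ?_⟩
    · rw [Multiset.Nodup.ext (hS.toFinset.nodup.map hf.1) hS.toFinset.nodup]
      intro a
      have := Set.ext_iff.1 hi a
      simpa using this
    · rw [← hn, Set.ncard_eq_toFinset_card S hS]; rfl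
    · apply Subtype.ext; ext a; simp

theorem card_sets {K : Type*} (f : K → K) (hf : f.Bijective) (n : ℕ) :
    Set.ncard {S : Set K | S.Finite ∧ S.ncard = n ∧ f '' S = S} = Nat.card (InvND f n) := by
  obtain ⟨F, hF⟩ := bij_sets f hf n
  rw [← Nat.card_coe_set_eq, Nat.card_eq_of_bijective F hF]

theorem count_proj {K X : Type*} (f : K → K) (s : X → X) (i : K → X) (p : X)
    (hi : i.Injective) (hp : ∀ a, i a ≠ p) (hx : ∀ x, x = p ∨ ∃ a, i a = x)
    (hs : ∀ a, s (i a) = i (f a)) (hsp : s p = p) (hf : f.Bijective)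
    [∀ n, Finite (InvND f n)] (n : ℕ) :
    nSetCount s Set.univ (n + 1) = Nat.card (InvND f (n + 1)) + Nat.card (InvND f n) := by
  have him : ∀ T : Set K, s '' (i '' T) = i '' (f '' T) := by
    intro T; simp only [Set.image_image, hs]
  have hpi : ∀ T : Set K, p ∉ i '' T := by
    rintro T ⟨a, -, h⟩; exact hp a h
  have hfin : ∀ n, {S : Set K | S.Finite ∧ S.ncard = n ∧ f '' S = S}.Finite := by
    intro n
    obtain ⟨F, hF⟩ := bij_sets f hf n
    have := Finite.of_surjective F hF.2
    exact Set.toFinite _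
  rw [← card_sets f hf, ← card_sets f hf, nSetCount]
  have hj : Function.Injective (fun T : Set K => i '' T) := hi.image_injective
  have hjp : Function.Injective (fun T : Set K => insert p (i '' T)) := by
    intro T U h
    apply hj
    have := congrArg (fun S => S \ {p}) h
    simpa [hpi] using this
  rw [← Set.ncard_image_of_injective _ hj, ← Set.ncard_image_of_injective {S : Set K | S.Finite ∧ S.ncard = n ∧ f '' S = S} hjp,
    ← Set.ncard_union_eq _ ((hfin _).image _) ((hfin _).image _)]
  · congr 1
    ext S
    simp only [Set.mem_ofPred_eq, Set.mem_union, Set.mem_image, Set.subset_univ, true_and]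
    constructor
    · rintro ⟨hS, hn, hinv⟩
      by_cases hpS : p ∈ S
      · right
        have hST : insert p (i '' (i ⁻¹' S)) = S := by
          ext x
          rcases hx x with rfl | ⟨a, rfl⟩
          · simp [hpS]
          · simp [hp, hi.eq_iff]
        refine ⟨i ⁻¹' S, ⟨hS.preimage hi.injOn, ?_, ?_⟩, hST⟩
        · rw [← hST, Set.ncard_insert_of_notMem (hpi _) ((hS.preimage hi.injOn).image _),
            Set.ncard_image_of_injective _ hi] at hn
          omega
        · rw [← hST, Set.image_insert_eq, him, hsp] at hinv
          have := congrArg (fun S => S \ {p}) hinv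
          apply hj
          simpa [hpi] using this
      · left
        have hST : i '' (i ⁻¹' S) = S := by
          ext x
          rcases hx x with rfl | ⟨a, rfl⟩
          · simp [hpS, hp]
          · simp [hi.eq_iff]
        refine ⟨i ⁻¹' S, ⟨hS.preimage hi.injOn, ?_, ?_⟩, hST⟩
        · rw [← hST, Set.ncard_image_of_injective _ hi] at hn
          exact hn
        · rw [← hST, him] at hinv
          exact hj hinv
    · rintro (⟨T, ⟨hT, hn, hinv⟩, rfl⟩ | ⟨T, ⟨hT, hn, hinv⟩, rfl⟩)
      · exact ⟨hT.image _, by rw [Set.ncard_image_of_injective _ hi, hn], by rw [him, hinv]⟩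
      · refine ⟨(hT.image _).insert _, ?_, by rw [Set.image_insert_eq, him, hinv, hsp]⟩
        rw [Set.ncard_insert_of_notMem (hpi _) (hT.image _), Set.ncard_image_of_injective _ hi, hn]
  · rw [Set.disjoint_left]
    rintro _ ⟨T, -, rfl⟩ ⟨U, -, h⟩
    have hh : insert p (i '' U) = i '' T := h
    exact hpi T (hh ▸ Set.mem_insert _ _)


theorem frob_bij (k : Type*) [Field k] [Fintype k] :
    Function.Bijective (fun x : AlgebraicClosure k => x ^ Fintype.card k) :=
  (FiniteField.frobeniusAlgEquivOfAlgebraic k (AlgebraicClosure k)).bijective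

open Polynomial in
theorem mem_range_of_fixed (k : Type*) [Field k] [Fintype k] (x : AlgebraicClosure k)
    (hx : x ^ Fintype.card k = x) : x ∈ (algebraMap k (AlgebraicClosure k)).range := by
  have hne : (X ^ Fintype.card k - X : k[X]) ≠ 0 :=
    FiniteField.X_pow_card_sub_X_ne_zero k Fintype.one_lt_card
  have hs : (X ^ Fintype.card k - X : k[X]).Splits := by
    rw [splits_iff_card_roots, FiniteField.roots_X_pow_card_sub_X,
      FiniteField.X_pow_card_sub_X_natDegree_eq k Fintype.one_lt_card]
    rfl
  apply hs.mem_range_of_isRoot hne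
  simp [hx]

open Polynomial in
theorem card_MS (k : Type*) [Field k] [Fintype k] (n : ℕ) :
    ∃ F : {p : k[X] // p.Monic ∧ p.natDegree = n} →
      InvMS (fun x : AlgebraicClosure k => x ^ Fintype.card k) n,
      F.Bijective := by
  let i := algebraMap k (AlgebraicClosure k)
  let φ := FiniteField.frobeniusAlgHom k (AlgebraicClosure k)
  have hφ : φ.toRingHom.comp i = i := φ.comp_algebraMap
  refine ⟨fun p => ⟨(p.1.map i).roots, ?_, ?_⟩, ?_, ?_⟩
  · have h := (IsAlgClosed.splits (p.1.map i)).roots_map φ.toRingHom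
    rw [Polynomial.map_map, hφ] at h
    exact h.symm
  · rw [← (IsAlgClosed.splits (p.1.map i)).natDegree_eq_card_roots, natDegree_map, p.2.2]
  · rintro ⟨p, hp, hpn⟩ ⟨r, hrr, hrn⟩ h
    simp only [Subtype.mk.injEq] at h
    apply Subtype.ext
    apply map_injective i i.injective
    rw [(IsAlgClosed.splits (p.map i)).eq_prod_roots_of_monic (hp.map i),
      (IsAlgClosed.splits (r.map i)).eq_prod_roots_of_monic (hrr.map i), h]
  · rintro ⟨M, hM, hn⟩
    let P := (M.map fun a => X - C a).prod
    have hPm : P.Monic := monic_multiset_prod_of_monic _ _ fun a _ => monic_X_sub_C a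
    have hP : P.map φ.toRingHom = P := by
      have h2 : P.map φ.toRingHom
          = ((M.map (fun x : AlgebraicClosure k => x ^ Fintype.card k)).map
              fun a => X - C a).prod := by
        simp only [P]
        rw [Polynomial.map_multiset_prod, Multiset.map_map, Multiset.map_map]
        congr 1
        refine Multiset.map_congr rfl fun a _ => ?_
        simp [φ]
      rw [h2, hM]
    have hl : P ∈ lifts i := by
      rw [lifts_iff_coeff_lifts]
      intro m
      have hm : (P.coeff m) ^ Fintype.card k = P.coeff m := by
        have := congrArg (fun Q => coeff Q m) hP
        simp only [coeff_map] at this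
        exact this
      exact mem_range_of_fixed k _ hm
    obtain ⟨p, hp1, hp2, hp3⟩ := lifts_and_natDegree_eq_and_monic hl hPm
    have hr : P.roots = M := roots_multiset_prod_X_sub_C M
    refine ⟨⟨p, hp3, ?_⟩, ?_⟩
    · rw [hp2, (IsAlgClosed.splits P).natDegree_eq_card_roots, hr, hn]
    · apply Subtype.ext
      simp only [hp1, hr]

open Polynomial in
theorem card_MSq (k : Type*) [Field k] [Fintype k] (n : ℕ) :
    Finite (InvMS (fun x : AlgebraicClosure k => x ^ Fintype.card k) n) ∧
    Nat.card (InvMS (fun x : AlgebraicClosure k => x ^ Fintype.card k) n) =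
      Fintype.card k ^ n := by
  obtain ⟨F, hF⟩ := card_MS k n
  let e := (Equiv.ofBijective F hF).symm.trans
    ((monicEquivDegreeLT n).trans (degreeLTEquiv k n).toEquiv)
  refine ⟨Finite.of_equiv _ e.symm, ?_⟩
  rw [Nat.card_congr e]
  simp

end counting

theorem projFrob_mk (k : Type*) [Field k] [Fintype k] (m : ℕ)
    (v : Fin m → AlgebraicClosure k) (hv : v ≠ 0) (hw : (fun i => v i ^ Fintype.card k) ≠ 0) :
    projFrob k m (Projectivization.mk _ v hv)
      = Projectivization.mk _ (fun i => v i ^ Fintype.card k) hw := by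
  obtain ⟨a, ha⟩ := Projectivization.exists_smul_eq_mk_rep (AlgebraicClosure k) v hv
  unfold projFrob
  rw [Projectivization.mk_eq_mk_iff']
  refine ⟨(a : AlgebraicClosure k) ^ Fintype.card k, ?_⟩
  funext i
  rw [← ha]
  simp [Units.smul_def, mul_pow]

theorem count_P1 (k : Type*) [Field k] [Fintype k] (n : ℕ) :
    nSetCount (projFrob k 2) Set.univ (n + 1) =
      Nat.card (InvND (fun x : AlgebraicClosure k => x ^ Fintype.card k) (n + 1)) +
      Nat.card (InvND (fun x : AlgebraicClosure k => x ^ Fintype.card k) n) := by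
  have hq0 : Fintype.card k ≠ 0 := Fintype.card_ne_zero
  have h1 : ∀ a : AlgebraicClosure k, (![a, 1] : Fin 2 → AlgebraicClosure k) ≠ 0 := by
    intro a h; simpa using congrFun h 1
  have h0 : (![1, 0] : Fin 2 → AlgebraicClosure k) ≠ 0 := by
    intro h; simpa using congrFun h 0
  have hfin : ∀ n, Finite (InvND (fun x : AlgebraicClosure k => x ^ Fintype.card k) n) := fun n =>
    have := (card_MSq k n).1
    Finite.of_injective (fun x => (⟨x.1, x.2.1⟩ : InvMS (fun x : AlgebraicClosure k => x ^ Fintype.card k) n))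
      (fun x y hxy => Subtype.ext (congrArg (fun z : InvMS _ n => z.1) hxy))
  refine count_proj _ _ (fun a => Projectivization.mk _ ![a, 1] (h1 a))
    (Projectivization.mk _ ![1, 0] h0) ?_ ?_ ?_ ?_ ?_ (frob_bij k) n
  · intro a b h
    obtain ⟨c, hc⟩ := (Projectivization.mk_eq_mk_iff' _ _ _ _ _).1 h
    have e0 := congrFun hc 0
    have e1 := congrFun hc 1
    simp at e0 e1
    simpa [e1] using e0.symm
  · intro a h
    obtain ⟨c, hc⟩ := (Projectivization.mk_eq_mk_iff' _ _ _ _ _).1 h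
    have e1 := congrFun hc 1
    simp at e1
  · intro x
    induction x using Projectivization.ind with
    | h v hv =>
      by_cases hv1 : v 1 = 0
      · left
        rw [Projectivization.mk_eq_mk_iff']
        refine ⟨v 0, ?_⟩
        funext j; fin_cases j <;> simp [hv1]
      · right
        refine ⟨v 0 / v 1, ?_⟩
        rw [Projectivization.mk_eq_mk_iff']
        refine ⟨(v 1)⁻¹, ?_⟩
        funext j; fin_cases j
        · simp; field_simp
        · simp [hv1]
  · intro a
    have e : (fun j => (![a, 1] : Fin 2 → AlgebraicClosure k) j ^ Fintype.card k)
        = ![a ^ Fintype.card k, 1] := by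
      funext j; fin_cases j <;> simp
    rw [projFrob_mk k 2 _ _ (by rw [e]; exact h1 _)]
    simp only [e]
  · have e : (fun j => (![1, 0] : Fin 2 → AlgebraicClosure k) j ^ Fintype.card k)
        = ![1, 0] := by
      funext j; fin_cases j <;> simp
    rw [projFrob_mk k 2 _ _ (by rw [e]; exact h0)]
    simp only [e]

/-- The number `a(n)` of `n`-element subsets `S ⊆ ℙ¹(k̄)` with `σ(S) = S`
satisfies `a(1) = q + 1`, `a(2) = q²` and `a(n) = qⁿ − q^{n−2}` for `n ≥ 3`. -/
theorem stmt5 (k : Type*) [Field k] [Fintype k] (q : ℕ)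
    (hq : Fintype.card k = q) :
    nSetCount (projFrob k 2) Set.univ 1 = q + 1 ∧
    nSetCount (projFrob k 2) Set.univ 2 = q ^ 2 ∧
    ∀ n : ℕ, 3 ≤ n → nSetCount (projFrob k 2) Set.univ n = q ^ n - q ^ (n - 2) := by
  subst hq
  have := fun n => (card_MSq k n).1
  obtain ⟨c0, c1, c2⟩ := card_ND (frob_bij k) (Fintype.card k) (fun n => (card_MSq k n).2)
  refine ⟨?_, ?_, ?_⟩
  · rw [count_P1 k 0, c1, c0]
  · have := c2 0
    rw [count_P1 k 1, c1]
    simpa using this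
  · intro n hn
    obtain ⟨m, rfl⟩ : ∃ m, n = m + 3 := ⟨n - 3, by omega⟩
    have e1 := c2 (m + 1)
    have e2 := c2 m
    rw [count_P1 k (m + 2), show m + 3 - 2 = m + 1 by omega]
    simp only [show m + 1 + 2 = m + 3 by omega, show m + 1 + 1 = m + 2 by omega] at e1
    rw [show m + 2 + 1 = m + 3 by omega]
    omega
end

section
/- Let a(n) be the number of n-element subsets S ⊆ ℙ²(k̄) with σ(S) = S. Then a(1) = q² + q + 1, a(2) = q⁴ + q³ + q², a(3) = q⁶ + q⁵ + q⁴ − q² − q, and a(n) = (q⁶ + q⁵ + q⁴ − q² − q − 1) · q^{2n−6} for all n ≥ 4. -/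
section
open Function

/-- stable finsets -/
def T6 {X : Type*} [DecidableEq X] (σ : X → X) (n : ℕ) : Set (Finset X) :=
  {S | S.card = n ∧ S.image σ = S}

theorem iter_mem6 {X : Type*} [DecidableEq X] {σ : X → X} {S : Finset X}
    (h : S.image σ = S) {x : X} (hx : x ∈ S) (j : ℕ) : σ^[j] x ∈ S := by
  induction j with
  | zero => simpa
  | succ j ih =>
    rw [Function.iterate_succ_apply', ← h]
    exact Finset.mem_image_of_mem _ ih

theorem period_le6 {X : Type*} [DecidableEq X] {σ : X → X} (hσ : Injective σ) {S : Finset X}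
    (h : S.image σ = S) {x : X} (hx : x ∈ S) :
    0 < minimalPeriod σ x ∧ minimalPeriod σ x ≤ S.card := by
  have h1 : ¬ Set.InjOn (fun j => σ^[j] x) (Finset.range (S.card + 1) : Set ℕ) := by
    intro hinj
    have := Finset.card_le_card_of_injOn (s := Finset.range (S.card+1)) (t := S)
      (fun j => σ^[j] x) (fun j _ => iter_mem6 h hx j) hinj
    simp at this
  have key : ∀ a b : ℕ, a < b → b < S.card + 1 → σ^[a] x = σ^[b] x →
      0 < minimalPeriod σ x ∧ minimalPeriod σ x ≤ S.card := by
    intro a b hab hb he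
    have : σ^[b - a] x = x := by
      apply hσ.iterate a
      rw [← Function.iterate_add_apply, Nat.add_sub_cancel' hab.le, he]
    have hp : IsPeriodicPt σ (b - a) x := this
    exact ⟨hp.minimalPeriod_pos (by omega), (hp.minimalPeriod_le (by omega)).trans (by omega)⟩
  simp only [Set.InjOn, not_forall] at h1
  obtain ⟨a, ha, b, hb, he, hne⟩ := h1
  simp only [Finset.coe_range, Set.mem_Iio] at ha hb
  rcases lt_or_gt_of_ne hne with h2 | h2
  · exact key a b h2 hb he
  · exact key b a h2 ha he.symm

/-- points of period at most n -/
def P6 {X : Type*} (σ : X → X) (n : ℕ) : Set X :=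
  {x | 0 < minimalPeriod σ x ∧ minimalPeriod σ x ≤ n}

theorem P6_fin {X : Type*} {σ : X → X} (hf : ∀ j, 0 < j → {x | σ^[j] x = x}.Finite) (n : ℕ) :
    (P6 σ n).Finite := by
  have : P6 σ n ⊆ ⋃ j ∈ Finset.Icc 1 n, {x | σ^[j] x = x} := by
    intro x hx
    simp only [Set.mem_iUnion]
    refine ⟨minimalPeriod σ x, by simp; exact ⟨hx.1, hx.2⟩, iterate_minimalPeriod⟩
  refine Set.Finite.subset ?_ this
  apply Set.Finite.biUnion (Finset.finite_toSet _)
  intro j hj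
  exact hf j (by simp at hj; omega)

theorem T6_fin {X : Type*} [DecidableEq X] {σ : X → X} (hσ : Injective σ)
    (hf : ∀ j, 0 < j → {x | σ^[j] x = x}.Finite) (n : ℕ) : (T6 σ n).Finite := by
  apply Set.Finite.subset (Finset.finite_toSet (P6_fin hf n).toFinset.powerset)
  intro S hS
  simp only [Finset.coe_powerset, Set.mem_preimage, Set.mem_powerset_iff]
  intro x hx
  simp only [Set.Finite.coe_toFinset]
  have := period_le6 hσ hS.2 hx
  rw [hS.1] at this
  exact this

/-- the orbit -/
noncomputable def O6 {X : Type*} [DecidableEq X] (σ : X → X) (x : X) : Finset X :=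
  (Finset.range (minimalPeriod σ x)).image (fun j => σ^[j] x)

theorem O6_card {X : Type*} [DecidableEq X] (σ : X → X) (x : X) :
    (O6 σ x).card = minimalPeriod σ x := by
  unfold O6
  rw [Finset.card_image_of_injOn, Finset.card_range]
  intro a ha b hb he
  simp at ha hb
  exact (iterate_eq_iterate_iff_of_lt_minimalPeriod ha hb).1 he

theorem O6_mem {X : Type*} [DecidableEq X] {σ : X → X} {x : X} (h : 0 < minimalPeriod σ x)
    (j : ℕ) : σ^[j] x ∈ O6 σ x := by
  unfold O6
  rw [Finset.mem_image]
  exact ⟨j % minimalPeriod σ x, by simpa using Nat.mod_lt _ h, iterate_mod_minimalPeriod_eq⟩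

theorem O6_image {X : Type*} [DecidableEq X] {σ : X → X} (hσ : Injective σ)
    {x : X} (h : 0 < minimalPeriod σ x) :
    (O6 σ x).image σ = O6 σ x := by
  apply Finset.eq_of_subset_of_card_le
  · intro y hy
    rw [Finset.mem_image] at hy
    obtain ⟨z, hz, rfl⟩ := hy
    unfold O6 at hz
    rw [Finset.mem_image] at hz
    obtain ⟨j, _, rfl⟩ := hz
    have := O6_mem h (j + 1)
    rwa [Function.iterate_succ_apply'] at this
  · rw [Finset.card_image_of_injective _ hσ]

theorem O6_sub {X : Type*} [DecidableEq X] {σ : X → X} {S : Finset X}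
    (h : S.image σ = S) {x : X} (hx : x ∈ S) : O6 σ x ⊆ S := by
  intro y hy
  unfold O6 at hy
  rw [Finset.mem_image] at hy
  obtain ⟨j, _, rfl⟩ := hy
  exact iter_mem6 h hx j

/-- if `x ∉ S` stable, the orbit is disjoint from `S` -/
theorem O6_disj {X : Type*} [DecidableEq X] {σ : X → X} {S : Finset X}
    (h : S.image σ = S) {x : X} (hx : x ∉ S) : Disjoint S (O6 σ x) := by
  rw [Finset.disjoint_left]
  intro y hy hy'
  unfold O6 at hy'
  rw [Finset.mem_image] at hy'
  obtain ⟨j, hj, rfl⟩ := hy'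
  apply hx
  simp at hj
  have := iter_mem6 h hy (minimalPeriod σ x - j)
  rwa [← Function.iterate_add_apply, Nat.sub_add_cancel hj.le, iterate_minimalPeriod] at this

/-- number of stable n-sets containing x -/
noncomputable def b6 {X : Type*} [DecidableEq X] (σ : X → X) (x : X) (n : ℕ) : ℕ :=
  {S ∈ T6 σ n | x ∈ S}.ncard

theorem b6_rec {X : Type*} [DecidableEq X] {σ : X → X} (hσ : Injective σ)
    (hf : ∀ j, 0 < j → {x | σ^[j] x = x}.Finite) {x : X} (h : 0 < minimalPeriod σ x) (n : ℕ) :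
    b6 σ x (n + minimalPeriod σ x) + b6 σ x n = (T6 σ n).ncard := by
  have hfin := T6_fin hσ hf n
  have h1 : b6 σ x (n + minimalPeriod σ x) = {S ∈ T6 σ n | x ∉ S}.ncard := by
    symm
    unfold b6
    apply Set.ncard_congr (fun S _ => S ∪ O6 σ x)
    · rintro S ⟨⟨h1, h2⟩, h3⟩
      refine ⟨⟨?_, ?_⟩, Finset.mem_union_right _ (O6_mem h 0)⟩
      · rw [Finset.card_union_of_disjoint (O6_disj h2 h3), h1, O6_card]
      · rw [Finset.image_union, h2, O6_image hσ h]
    · rintro S S' ⟨⟨h1, h2⟩, h3⟩ ⟨⟨h1', h2'⟩, h3'⟩ he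
      have e1 := Finset.union_sdiff_cancel_right (O6_disj h2 h3)
      have e2 := Finset.union_sdiff_cancel_right (O6_disj h2' h3')
      rw [← e1, show S ∪ O6 σ x = S' ∪ O6 σ x from he, e2]
    · rintro S ⟨⟨h1, h2⟩, h3⟩
      refine ⟨S \ O6 σ x, ⟨⟨?_, ?_⟩, ?_⟩, Finset.sdiff_union_of_subset (O6_sub h2 h3)⟩
      · rw [Finset.card_sdiff_of_subset (O6_sub h2 h3), h1, O6_card]; omega
      · rw [Finset.image_sdiff _ _ hσ, h2, O6_image hσ h]
      · simp [show x ∈ O6 σ x from O6_mem h 0]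
  rw [h1, add_comm]
  unfold b6
  rw [← Set.ncard_union_eq ?_ (hfin.subset (fun S hS => hS.1)) (hfin.subset (fun S hS => hS.1))]
  · congr 1
    ext S
    simp only [Set.mem_union, Set.mem_ofPred_eq]
    tauto
  · rw [Set.disjoint_left]
    rintro S ⟨_, h⟩ ⟨_, h'⟩
    exact h' h

theorem b6_zero {X : Type*} [DecidableEq X] {σ : X → X} (hσ : Injective σ)
    {x : X} {n : ℕ} (h : n < minimalPeriod σ x) :
    b6 σ x n = 0 := by
  unfold b6
  have he : {S ∈ T6 σ n | x ∈ S} = ∅ := by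
    rw [Set.eq_empty_iff_forall_notMem]
    rintro S ⟨⟨h1, h2⟩, h3⟩
    have := (period_le6 hσ h2 h3).2
    omega
  rw [he, Set.ncard_empty]

theorem sum_b6 {X : Type*} [DecidableEq X] {σ : X → X} (hσ : Injective σ)
    (hf : ∀ j, 0 < j → {x | σ^[j] x = x}.Finite) (n : ℕ) :
    n * (T6 σ n).ncard = ∑ x ∈ (P6_fin hf n).toFinset, b6 σ x n := by
  have hfin := T6_fin hσ hf n
  have := Finset.sum_card_bipartiteAbove_eq_sum_card_bipartiteBelow (s := hfin.toFinset)
    (t := (P6_fin hf n).toFinset) (fun S x => x ∈ S)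
  have e1 : ∀ S ∈ hfin.toFinset,
      (Finset.bipartiteAbove (fun (S : Finset X) x => x ∈ S) (P6_fin hf n).toFinset S).card = n := by
    intro S hS
    rw [Set.Finite.mem_toFinset] at hS
    refine Eq.trans (congrArg Finset.card (?_ : _ = S)) hS.1
    ext x
    simp only [Finset.mem_bipartiteAbove, Set.Finite.mem_toFinset]
    refine ⟨fun h => h.2, fun h => ⟨?_, h⟩⟩
    have := period_le6 hσ hS.2 h
    rwa [hS.1] at this
  have e2 : ∀ x ∈ (P6_fin hf n).toFinset,
      (Finset.bipartiteBelow (fun (S : Finset X) x => x ∈ S) hfin.toFinset x).card = b6 σ x n := by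
    intro x hx
    unfold b6
    rw [← Set.ncard_coe_finset]
    congr 1
    ext S
    simp
  rw [Finset.sum_congr rfl e1, Finset.sum_congr rfl e2, Finset.sum_const, smul_eq_mul, mul_comm,
    ← Set.ncard_eq_toFinset_card _ hfin] at this
  exact this

/-- sign weights -/
noncomputable def eps6 (d j : ℕ) : ℤ :=
  if j = 0 then 0 else (if d ∣ j then 1 else 0) - 2 * (if 2 ∣ j ∧ d ∣ j / 2 then 1 else 0)

theorem eps6_lt {d j : ℕ} (h : j < d) : eps6 d j = 0 := by
  unfold eps6
  split_ifs with h1 h2 h3 h4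
  all_goals first | rfl | skip
  · exact absurd (Nat.le_of_dvd (by omega) h2) (by omega)
  · exact absurd (Nat.le_of_dvd (by omega) h2) (by omega)
  · exact absurd (Nat.le_of_dvd (by omega) h4.2) (by omega)

theorem eps6_self {d : ℕ} (h : 0 < d) : eps6 d d = 1 := by
  unfold eps6
  rw [if_neg h.ne', if_pos dvd_rfl, if_neg]
  · rfl
  · rintro ⟨h1, h2⟩
    have := Nat.le_of_dvd (by omega) h2
    omega

theorem half6 {d : ℕ} (m : ℕ) (h : 0 < d) : (2 ∣ d * m ∧ d ∣ (d * m) / 2) ↔ 2 ∣ m := by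
  constructor
  · rintro ⟨h1, c, hc⟩
    obtain ⟨e, he⟩ := h1
    rw [he, Nat.mul_div_cancel_left _ (by norm_num)] at hc
    refine ⟨c, ?_⟩
    apply Nat.eq_of_mul_eq_mul_left h
    rw [he, hc]; ring
  · rintro ⟨c, rfl⟩
    refine ⟨⟨d * c, by ring⟩, c, ?_⟩
    rw [show d * (2 * c) = 2 * (d * c) by ring, Nat.mul_div_cancel_left _ (by norm_num)]

theorem half6' {d j : ℕ} (h : 2 ∣ j ∧ d ∣ j / 2) : d ∣ j := by
  obtain ⟨⟨c, rfl⟩, h⟩ := h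
  rw [Nat.mul_div_cancel_left _ (by norm_num)] at h
  exact h.mul_left 2

theorem eps6_mul {d m : ℕ} (h : 0 < d) (hm : 0 < m) :
    eps6 d (d * m) = if 2 ∣ m then -1 else 1 := by
  unfold eps6
  rw [if_neg (by positivity), if_pos (dvd_mul_right _ _)]
  simp only [half6 m h]
  split_ifs <;> rfl

theorem eps6_ndvd {d j : ℕ} (h : ¬ d ∣ j) : eps6 d j = 0 := by
  unfold eps6
  rw [if_neg h, if_neg (fun h' => h (half6' h'))]
  simp

theorem eps6_rec {d i : ℕ} (h : 0 < d) (hi : 0 < i) : eps6 d (i + d) + eps6 d i = 0 := by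
  by_cases hd : d ∣ i
  · obtain ⟨m, rfl⟩ := hd
    have hm : 0 < m := Nat.pos_of_mul_pos_left hi
    rw [show d * m + d = d * (m + 1) by ring, eps6_mul h hm, eps6_mul h (by omega)]
    split_ifs <;> first | rfl | omega
  · rw [eps6_ndvd hd, eps6_ndvd]
    · rfl
    · rwa [Nat.dvd_add_left dvd_rfl]

theorem b6_eq {X : Type*} [DecidableEq X] {σ : X → X} (hσ : Injective σ)
    (hf : ∀ j, 0 < j → {x | σ^[j] x = x}.Finite) {x : X} (h : 0 < minimalPeriod σ x) :
    PowerSeries.mk (fun n => (b6 σ x n : ℤ)) =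
      PowerSeries.mk (fun n => eps6 (minimalPeriod σ x) n) *
        PowerSeries.mk (fun n => ((T6 σ n).ncard : ℤ)) := by
  set d := minimalPeriod σ x with hd
  set A := PowerSeries.mk (fun n => ((T6 σ n).ncard : ℤ)) with hA
  have h1 : PowerSeries.mk (fun n => (b6 σ x n : ℤ)) * (1 + PowerSeries.X ^ d) =
      PowerSeries.X ^ d * A := by
    ext n
    rw [mul_add, mul_one, map_add, PowerSeries.coeff_mul_X_pow', PowerSeries.coeff_X_pow_mul']
    split_ifs with hn
    · obtain ⟨i, rfl⟩ := Nat.exists_eq_add_of_le' hn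
      simp only [PowerSeries.coeff_mk, hA, Nat.add_sub_cancel]
      exact_mod_cast b6_rec hσ hf h i
    · simp only [PowerSeries.coeff_mk, add_zero]
      exact_mod_cast b6_zero hσ (by omega)
  have h2 : PowerSeries.mk (fun n => eps6 d n) * (1 + PowerSeries.X ^ d) = PowerSeries.X ^ d := by
    ext n
    rw [mul_add, mul_one, map_add, PowerSeries.coeff_mul_X_pow', PowerSeries.coeff_X_pow]
    split_ifs with hn hn' hn'
    · subst hn'
      rw [PowerSeries.coeff_mk, PowerSeries.coeff_mk, eps6_self h, Nat.sub_self]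
      simp [eps6]
    · obtain ⟨i, rfl⟩ := Nat.exists_eq_add_of_le' hn
      simp only [PowerSeries.coeff_mk, Nat.add_sub_cancel]
      exact eps6_rec h (by omega)
    · omega
    · simp only [PowerSeries.coeff_mk, add_zero]
      exact eps6_lt (by omega)
  have h3 : (1 + PowerSeries.X ^ d : PowerSeries ℤ) ≠ 0 := by
    intro h0
    have := congrArg (PowerSeries.coeff 0) h0
    rw [map_add, PowerSeries.coeff_X_pow, if_neg h.ne] at this
    simp at this
  apply mul_right_cancel₀ h3
  rw [h1]
  linear_combination (-A) * h2

/-- The logarithmic derivative recurrence. -/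
theorem main_rec6 {X : Type*} [DecidableEq X] {σ : X → X} (hσ : Injective σ)
    (hf : ∀ j, 0 < j → {x | σ^[j] x = x}.Finite) (c : ℕ → ℤ) (hc0 : c 0 = 0)
    (hc : ∀ j, 0 < j → c j = {x | σ^[j] x = x}.ncard -
      2 * (if 2 ∣ j then ({x | σ^[j/2] x = x}.ncard : ℤ) else 0)) (n : ℕ) :
    (n : ℤ) * (T6 σ n).ncard =
      PowerSeries.coeff n (PowerSeries.mk c * PowerSeries.mk (fun n => ((T6 σ n).ncard : ℤ))) := by
  have h1 := congrArg (Nat.cast : ℕ → ℤ) (sum_b6 hσ hf n)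
  push_cast at h1
  rw [h1]
  have h2 : ∀ x ∈ (P6_fin hf n).toFinset, (b6 σ x n : ℤ) =
      ∑ p ∈ Finset.HasAntidiagonal.antidiagonal n, eps6 (minimalPeriod σ x) p.1 * (T6 σ p.2).ncard := by
    intro x hx
    rw [Set.Finite.mem_toFinset] at hx
    have := congrArg (PowerSeries.coeff n) (b6_eq hσ hf hx.1)
    rw [PowerSeries.coeff_mul] at this
    simpa using this
  rw [Finset.sum_congr rfl h2, Finset.sum_comm, PowerSeries.coeff_mul]
  apply Finset.sum_congr rfl
  rintro ⟨i, j⟩ hij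
  rw [Finset.HasAntidiagonal.mem_antidiagonal] at hij
  simp only at hij
  rw [← Finset.sum_mul]
  simp only [PowerSeries.coeff_mk]
  congr 1
  have key : ∀ i, 0 < i → i ≤ n →
      ∑ x ∈ (P6_fin hf n).toFinset, (if minimalPeriod σ x ∣ i then (1:ℤ) else 0) =
        {x | σ^[i] x = x}.ncard := by
    intro i hi hin
    rw [Finset.sum_boole]
    congr 1
    rw [← Set.ncard_coe_finset]
    congr 1
    ext x
    simp only [Finset.coe_filter, Set.Finite.mem_toFinset, Set.mem_ofPred_eq]
    rw [← isPeriodicPt_iff_minimalPeriod_dvd]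
    constructor
    · exact fun h => h.2
    · exact fun (h : IsPeriodicPt σ i x) => ⟨⟨h.minimalPeriod_pos hi, (h.minimalPeriod_le hi).trans hin⟩, h⟩
  rcases Nat.eq_zero_or_pos i with rfl | hi
  · simp [eps6, hc0]
  · rw [hc i hi, ← key i hi (by omega)]
    simp only [eps6, hi.ne', if_false]
    rw [Finset.sum_sub_distrib, ← Finset.mul_sum]
    congr 2
    split_ifs with h2
    · rw [← key (i/2) (by omega) (by omega)]
      simp [h2]
    · simp [h2]

end

open PowerSeries in
theorem series6 (q : ℤ) (a c : ℕ → ℤ) (h0 : a 0 = 1) (hc0 : c 0 = 0)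
    (hc : ∀ j, 0 < j → c j = (1 + q ^ j + q ^ (2 * j)) -
      2 * (if 2 ∣ j then (1 + q ^ (j/2) + q ^ (2 * (j/2))) else 0))
    (hrec : ∀ n : ℕ, (n : ℤ) * a n = coeff n (mk c * mk a)) :
    mk a * (1 - C (q^2) * X) = (1 + X) * (1 + C q * X) * (1 - C q * X ^ 2) := by
  have geo : ∀ r : ℤ, mk (fun n => r ^ n) * (1 - C r * X) = 1 := by
    intro r
    ext n
    rw [mul_sub, mul_one, map_sub, ← mul_assoc]
    rcases n with _ | n
    · simp
    · rw [coeff_succ_mul_X, coeff_mul_C, coeff_mk, coeff_mk, coeff_one]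
      simp [pow_succ]
  have hd : ∀ F : PowerSeries ℤ, ∀ n : ℕ, coeff n (X * derivative ℤ F) = n * coeff n F := by
    intro F n
    rcases n with _ | n
    · simp
    · rw [mul_comm, coeff_succ_mul_X, coeff_derivative]
      push_cast; ring
  set G : PowerSeries ℤ := mk (fun n => (q^2) ^ n) with hG
  have hG1 : G * (1 - C (q^2) * X) = 1 := geo _
  set C1 : PowerSeries ℤ := C (-1) * (mk (fun n => (-1 : ℤ) ^ n) - 1) with hC1
  set C2 : PowerSeries ℤ := C (-1) * (mk (fun n => (-q : ℤ) ^ n) - 1) with hC2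
  set C3 : PowerSeries ℤ := G - 1 with hC3
  set C4 : PowerSeries ℤ := C (-2) * (mk (fun n => if 2 ∣ n then q ^ (n / 2) else 0) - 1) with hC4
  have e1 : C1 * (1 + X) = X := by
    have := geo (-1)
    simp only [hC1, map_neg, map_one] at this ⊢
    linear_combination (-1) * this
  have e2 : C2 * (1 + C q * X) = C q * X := by
    have := geo (-q)
    simp only [hC2, map_neg, map_one] at this ⊢
    linear_combination (-1) * this
  have e3 : C3 * (1 - C (q^2) * X) = C (q^2) * X := by
    rw [hC3]; linear_combination hG1
  have e4' : mk (fun n => if 2 ∣ n then q ^ (n / 2) else 0) * (1 - C q * X ^ 2) = 1 := by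
    ext n
    rw [mul_sub, mul_one, map_sub, ← mul_assoc, coeff_mul_X_pow']
    rcases n with _ | _ | n
    · simp
    · simp [coeff_one]
    · rw [if_pos (by omega), coeff_mul_C, coeff_one, if_neg (by omega)]
      simp only [coeff_mk, show n + 1 + 1 - 2 = n by omega,
        show (n + 1 + 1) / 2 = n / 2 + 1 by omega, show 2 ∣ n + 1 + 1 ↔ 2 ∣ n by omega]
      split_ifs
      · ring
      · ring
  have e4 : C4 * (1 - C q * X ^ 2) = - 2 * C q * X ^ 2 := by
    have : (C (-2) : PowerSeries ℤ) = -2 := by simp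
    rw [hC4, this]; linear_combination (-2) * e4'
  have hcs : mk c = C1 + C2 + C3 + C4 := by
    ext n
    simp only [hC1, hC2, hC3, hC4, hG, map_add, coeff_C_mul, map_sub, coeff_mk, coeff_one]
    rcases Nat.eq_zero_or_pos n with rfl | hn
    · simp [hc0]
    · rw [hc n hn]
      simp only [hn.ne', if_false]
      split_ifs with h2
      · obtain ⟨m, rfl⟩ := h2
        simp only [Nat.mul_div_cancel_left m (show 0 < 2 by norm_num), pow_mul]
        simp; ring
      · have ho : Odd n := by rw [← Nat.not_even_iff_odd]; rwa [even_iff_two_dvd]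
        rw [ho.neg_pow, ho.neg_pow, pow_mul]; simp
  set F : PowerSeries ℤ := (1 + X) * (1 + C q * X) * (1 - C q * X ^ 2) with hF
  set B : PowerSeries ℤ := F * G with hB
  have dG : derivative ℤ G * (1 - C (q^2) * X) = C (q^2) * G := by
    have := congrArg (derivative ℤ) hG1
    simp only [Derivation.leibniz, map_sub, smul_eq_mul, derivative_X, derivative_C, Derivation.map_one_eq_zero] at this
    linear_combination this
  have u3 : (1 - C (q^2) * X : PowerSeries ℤ) ≠ 0 := right_ne_zero_of_mul_eq_one hG1
  have dG' : X * derivative ℤ G = C3 * G := by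
    apply mul_right_cancel₀ u3
    linear_combination X * dG - G * e3
  have dF : X * derivative ℤ F = (C1 + C2 + C4) * F := by
    simp only [hF, Derivation.leibniz, map_sub, map_add, smul_eq_mul, derivative_X, derivative_C, Derivation.map_one_eq_zero, Derivation.leibniz_pow, nsmul_eq_mul]
    push_cast
    linear_combination (-(1 + C q * X) * (1 - C q * X ^ 2)) * e1
      - ((1 + X) * (1 - C q * X ^ 2)) * e2 - ((1 + X) * (1 + C q * X)) * e4
  have dB : X * derivative ℤ B = mk c * B := by
    rw [hB, Derivation.leibniz, hcs, smul_eq_mul, smul_eq_mul]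
    linear_combination F * dG' + G * dF
  have hAB : ∀ n, a n = coeff n B := by
    intro n
    induction n using Nat.strong_induction_on with
    | _ n ih =>
      rcases Nat.eq_zero_or_pos n with rfl | hn
      · rw [h0]; simp [hB, hF, hG]
      · have h1 := hrec n
        have h2 := hd B n
        rw [dB] at h2
        have : coeff n (mk c * mk a) = coeff n (mk c * B) := by
          rw [coeff_mul, coeff_mul]
          apply Finset.sum_congr rfl
          rintro ⟨i, j⟩ hij
          rw [Finset.HasAntidiagonal.mem_antidiagonal] at hij
          simp only at hij
          rcases Nat.eq_zero_or_pos i with rfl | hi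
          · simp only [coeff_mk, hc0, zero_mul]
          · simp only [coeff_mk]
            rw [ih j (by omega)]
        rw [this, h2] at h1
        exact mul_left_cancel₀ (by exact_mod_cast hn.ne') h1
  have : mk a = B := by ext n; rw [coeff_mk, hAB]
  rw [this, hB]
  linear_combination F * hG1

open PowerSeries in
theorem closed6 (q : ℤ) (a : ℕ → ℤ) 
    (h : mk a * (1 - C (q^2) * X) = (1 + X) * (1 + C q * X) * (1 - C q * X ^ 2)) :
    a 1 = q^2 + q + 1 ∧ a 2 = q ^ 4 + q ^ 3 + q ^ 2 ∧ a 3 = q ^ 6 + q ^ 5 + q ^ 4 - q ^ 2 - q ∧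
    ∀ m : ℕ, a (m + 4) = (q ^ 6 + q ^ 5 + q ^ 4 - q ^ 2 - q - 1) * q ^ (2 * m + 2) := by
  have h' : mk a * (1 - C (q^2) * X) = (((1 : Polynomial ℤ) + Polynomial.C (1 + q) * Polynomial.X - Polynomial.C (q + q^2) * Polynomial.X ^ 3 - Polynomial.C (q^2) * Polynomial.X ^ 4 : Polynomial ℤ) : PowerSeries ℤ) := by
    rw [h]; push_cast; simp only [map_add, map_one, map_pow]; ring
  have k0 := congrArg (coeff 0) h'
  have ks : ∀ n, a (n+1) - q^2 * a n = coeff (n+1) (((1 : Polynomial ℤ) + Polynomial.C (1 + q) * Polynomial.X - Polynomial.C (q + q^2) * Polynomial.X ^ 3 - Polynomial.C (q^2) * Polynomial.X ^ 4 : Polynomial ℤ) : PowerSeries ℤ) := by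
    intro n
    have := congrArg (coeff (n+1)) h'
    rw [mul_sub, mul_one, map_sub, ← mul_assoc, coeff_succ_mul_X, coeff_mul_C, coeff_mk, coeff_mk, mul_comm] at this
    exact this
  simp only [Polynomial.coeff_coe, Polynomial.coeff_sub, Polynomial.coeff_add, Polynomial.coeff_C_mul, Polynomial.coeff_X_pow, Polynomial.coeff_X, Polynomial.coeff_one] at ks
  have a0 : a 0 = 1 := by simpa using k0
  have a1 := ks 0
  have a2 := ks 1
  have a3 := ks 2
  have a4 := ks 3
  have a5 : ∀ m, a (m + 5) - q^2 * a (m + 4) = 0 := by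
    intro m
    have := ks (m + 4)
    rw [this]; simp
  norm_num [a0] at a1 a2 a3 a4
  have a1' : a 1 = q^2 + q + 1 := by linear_combination a1
  have a2' : a 2 = q ^ 4 + q ^ 3 + q ^ 2 := by rw [a1'] at a2; linear_combination a2
  have a3' : a 3 = q ^ 6 + q ^ 5 + q ^ 4 - q ^ 2 - q := by rw [a2'] at a3; linear_combination a3
  refine ⟨a1', a2', a3', ?_⟩
  intro m
  induction m with
  | zero => rw [a3'] at a4; linear_combination a4
  | succ m ih =>
    have := a5 m
    rw [ih] at this
    rw [show m + 1 + 4 = m + 5 by ring]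
    linear_combination this

theorem frob_mk6 (k : Type*) [Field k] [Fintype k] (m : ℕ) (v : Fin m → AlgebraicClosure k)
    (hv : v ≠ 0) (hv' : (fun i => v i ^ Fintype.card k) ≠ 0) :
    projFrob k m (Projectivization.mk _ v hv) = Projectivization.mk _ (fun i => v i ^ Fintype.card k) hv' := by
  obtain ⟨a, ha⟩ := Projectivization.exists_smul_eq_mk_rep (AlgebraicClosure k) v hv
  unfold projFrob
  rw [Projectivization.mk_eq_mk_iff]
  refine ⟨a ^ Fintype.card k, ?_⟩
  funext i
  rw [← ha]
  simp [Units.smul_def, mul_pow]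

/-- normal form parametrisation of the projective plane -/
noncomputable def phi6 (L : Type*) [Field L] : (L × L) ⊕ (L ⊕ Unit) → Projectivization L (Fin 3 → L)
  | .inl (a, b) => Projectivization.mk L ![1, a, b] (fun h => one_ne_zero (congrFun h 0))
  | .inr (.inl a) => Projectivization.mk L ![0, 1, a] (fun h => one_ne_zero (congrFun h 1))
  | .inr (.inr _) => Projectivization.mk L ![0, 0, 1] (fun h => one_ne_zero (congrFun h 2))

theorem phi6_inj (L : Type*) [Field L] : Function.Injective (phi6 L) := by
  intro x y h
  rcases x with ⟨a, b⟩ | a | _ <;> rcases y with ⟨c, d⟩ | c | _ <;>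
    first | rfl | skip
  all_goals
    simp only [phi6, Projectivization.mk_eq_mk_iff'] at h <;> rcases h with ⟨u, hu⟩ <;>
    have h0 := congrFun hu 0 <;> have h1 := congrFun hu 1 <;> have h2 := congrFun hu 2 <;>
    simp at h0 h1 h2 <;> simp_all

theorem phi6_surj (L : Type*) [Field L] : Function.Surjective (phi6 L) := by
  intro P
  induction P using Projectivization.ind with
  | h v hv =>
    by_cases h0 : v 0 = 0
    · by_cases h1 : v 1 = 0
      · have h2 : v 2 ≠ 0 := by
          intro h2
          apply hv
          funext i
          fin_cases i <;> simp [h0, h1, h2]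
        refine ⟨.inr (.inr ()), ?_⟩
        simp only [phi6, Projectivization.mk_eq_mk_iff']
        refine ⟨(v 2)⁻¹, ?_⟩
        funext i
        fin_cases i <;> simp [h0, h1, h2]
      · refine ⟨.inr (.inl ((v 1)⁻¹ * v 2)), ?_⟩
        simp only [phi6, Projectivization.mk_eq_mk_iff']
        refine ⟨(v 1)⁻¹, ?_⟩
        funext i
        fin_cases i <;> simp [h0, h1]
    · refine ⟨.inl ((v 0)⁻¹ * v 1, (v 0)⁻¹ * v 2), ?_⟩
      simp only [phi6, Projectivization.mk_eq_mk_iff']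
      refine ⟨(v 0)⁻¹, ?_⟩
      funext i
      fin_cases i <;> simp [h0]

/-- coordinatewise map -/
def tau6 {L : Type*} (f : L → L) : (L × L) ⊕ (L ⊕ Unit) → (L × L) ⊕ (L ⊕ Unit) :=
  Sum.map (Prod.map f f) (Sum.map f id)

theorem semi6 (k : Type*) [Field k] [Fintype k] :
    Function.Semiconj (phi6 (AlgebraicClosure k)) (tau6 (fun x => x ^ Fintype.card k))
      (projFrob k 3) := by
  have hq : Fintype.card k ≠ 0 := Fintype.card_ne_zero
  intro x
  rcases x with ⟨a, b⟩ | a | _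
  · simp only [phi6, tau6, Sum.map_inl, Prod.map]
    rw [frob_mk6]
    · congr 1
      funext i; fin_cases i <;> simp
    · exact fun h => one_ne_zero (α := AlgebraicClosure k) (by simpa using congrFun h 0)
  · simp only [phi6, tau6, Sum.map_inl, Sum.map_inr]
    rw [frob_mk6]
    · congr 1
      funext i; fin_cases i <;> simp [hq]
    · exact fun h => one_ne_zero (α := AlgebraicClosure k) (by simpa using congrFun h 1)
  · simp only [phi6, tau6, Sum.map_inr]
    rw [frob_mk6]
    · congr 1
      funext i; fin_cases i <;> simp [hq]
    · exact fun h => one_ne_zero (α := AlgebraicClosure k) (by simpa using congrFun h 2)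

theorem frob_inj6 (k : Type*) [Field k] [Fintype k] :
    Function.Injective (fun x : AlgebraicClosure k => x ^ Fintype.card k) := by
  obtain ⟨n, hp, hn⟩ := FiniteField.card k (ringChar k)
  have : Fact (ringChar k).Prime := ⟨hp⟩
  have : CharP (AlgebraicClosure k) (ringChar k) := charP_of_injective_algebraMap (algebraMap k _).injective _
  rw [hn]
  exact iterateFrobenius_inj (AlgebraicClosure k) (ringChar k) n

theorem projFrob_inj6 (k : Type*) [Field k] [Fintype k] : Function.Injective (projFrob k 3) := by
  intro x y h
  obtain ⟨x, rfl⟩ := phi6_surj _ x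
  obtain ⟨y, rfl⟩ := phi6_surj _ y
  rw [← semi6 k x, ← semi6 k y] at h
  have h := phi6_inj _ h
  have hi := frob_inj6 k
  have : Function.Injective (tau6 (fun x : AlgebraicClosure k => x ^ Fintype.card k)) :=
    (hi.prodMap hi).sumMap (hi.sumMap Function.injective_id)
  rw [this h]

theorem fix_card6 (k : Type*) [Field k] [Fintype k] (j : ℕ) (hj : 0 < j) :
    {x : AlgebraicClosure k | x ^ (Fintype.card k ^ j) = x}.Finite ∧
    {x : AlgebraicClosure k | x ^ (Fintype.card k ^ j) = x}.ncard = Fintype.card k ^ j := by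
  classical
  obtain ⟨n, hp, hn⟩ := FiniteField.card k (ringChar k)
  have : Fact (ringChar k).Prime := ⟨hp⟩
  have : CharP (AlgebraicClosure k) (ringChar k) := charP_of_injective_algebraMap (algebraMap k _).injective _
  set p := ringChar k
  have hQ : Fintype.card k ^ j = p ^ (n * j) := by rw [hn, pow_mul]
  rw [hQ]
  have hne : (n : ℕ) * j ≠ 0 := by positivity
  have h1 : 1 < p ^ ((n : ℕ) * j) := Nat.one_lt_pow hne hp.one_lt
  set Q := p ^ ((n : ℕ) * j)
  set f : Polynomial (AlgebraicClosure k) := Polynomial.X ^ Q - Polynomial.X with hf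
  have hdeg : f.natDegree = Q := FiniteField.X_pow_card_sub_X_natDegree_eq _ h1
  have hf0 : f ≠ 0 := FiniteField.X_pow_card_sub_X_ne_zero _ h1
  have hsep : f.Separable := galois_poly_separable p Q (dvd_pow_self p hne)
  have hs : {x : AlgebraicClosure k | x ^ Q = x} = (f.roots.toFinset : Set _) := by
    ext x
    rw [Finset.mem_coe, Multiset.mem_toFinset, Polynomial.mem_roots hf0]
    simp [Polynomial.IsRoot, hf, sub_eq_zero]
  rw [hs]
  refine ⟨Finset.finite_toSet _, ?_⟩
  rw [Set.ncard_coe_finset, Multiset.toFinset_card_of_nodup (Polynomial.nodup_roots hsep),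
    ← (IsAlgClosed.splits f).natDegree_eq_card_roots, hdeg]

theorem tau6_fix {L : Type*} (f : L → L) (N : ℕ) (h : {x | f x = x}.Finite)
    (hN : {x | f x = x}.ncard = N) :
    {x | tau6 f x = x}.Finite ∧ {x | tau6 f x = x}.ncard = 1 + N + N ^ 2 := by
  set F := {x | f x = x} with hF
  have hs : {x | tau6 f x = x} = Sum.inl '' (F ×ˢ F) ∪ (Sum.inr '' (Sum.inl '' F) ∪ {Sum.inr (Sum.inr ())}) := by
    ext x
    rcases x with ⟨a, b⟩ | a | _ <;> simp [tau6, hF]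
  rw [hs]
  have f1 : (Sum.inl '' (F ×ˢ F) : Set ((L × L) ⊕ (L ⊕ Unit))).Finite := (h.prod h).image _
  have f2 : (Sum.inr '' (Sum.inl '' F) : Set ((L × L) ⊕ (L ⊕ Unit))).Finite := (h.image _).image _
  have f3 : ({Sum.inr (Sum.inr ())} : Set ((L × L) ⊕ (L ⊕ Unit))).Finite := Set.finite_singleton _
  refine ⟨f1.union (f2.union f3), ?_⟩
  rw [Set.ncard_union_eq _ f1 (f2.union f3), Set.ncard_union_eq _ f2 f3,
    Set.ncard_image_of_injective _ Sum.inl_injective, Set.ncard_image_of_injective _ Sum.inr_injective,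
    Set.ncard_image_of_injective _ Sum.inl_injective, Set.ncard_prod, hN, Set.ncard_singleton]
  · ring
  · simp [Set.disjoint_left]
  · simp [Set.disjoint_left]

theorem tau6_iter {L : Type*} (f : L → L) (j : ℕ) : (tau6 f)^[j] = tau6 (f^[j]) := by
  induction j with
  | zero => funext x; rcases x with ⟨a, b⟩ | a | _ <;> simp [tau6]
  | succ j ih =>
    rw [Function.iterate_succ', ih, Function.iterate_succ']
    funext x; rcases x with ⟨a, b⟩ | a | _ <;> simp [tau6]

theorem proj_fix6 (k : Type*) [Field k] [Fintype k] (j : ℕ) (hj : 0 < j) :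
    {x | (projFrob k 3)^[j] x = x}.Finite ∧
    {x | (projFrob k 3)^[j] x = x}.ncard =
      1 + Fintype.card k ^ j + (Fintype.card k ^ j) ^ 2 := by
  have hs : {x | (projFrob k 3)^[j] x = x} =
      phi6 _ '' {x | tau6 (fun x : AlgebraicClosure k => x ^ (Fintype.card k ^ j)) x = x} := by
    have hit : (fun x : AlgebraicClosure k => x ^ (Fintype.card k ^ j)) = (fun x => x ^ Fintype.card k)^[j] := by
      rw [pow_iterate]
    rw [hit, ← tau6_iter]
    have hsc := (semi6 k).iterate_right j
    ext y
    simp only [Set.mem_ofPred_eq, Set.mem_image]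
    constructor
    · intro hy
      obtain ⟨x, rfl⟩ := phi6_surj _ y
      refine ⟨x, ?_, rfl⟩
      rw [← hsc x] at hy
      exact phi6_inj _ hy
    · rintro ⟨x, hx, rfl⟩
      rw [← hsc x, hx]
  obtain ⟨h1, h2⟩ := fix_card6 k j hj
  obtain ⟨h3, h4⟩ := tau6_fix _ _ h1 h2
  rw [hs]
  exact ⟨h3.image _, by rw [Set.ncard_image_of_injective _ (phi6_inj _), h4]⟩

theorem nSet_eq6 {X : Type*} [DecidableEq X] (σ : X → X) (n : ℕ) :
    nSetCount σ Set.univ n = (T6 σ n).ncard := by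
  symm
  unfold nSetCount
  apply Set.ncard_congr (fun (S : Finset X) _ => (S : Set X))
  · rintro S ⟨h1, h2⟩
    refine ⟨Set.subset_univ _, Finset.finite_toSet _, ?_, ?_⟩
    · rw [Set.ncard_coe_finset, h1]
    · rw [← Finset.coe_image, h2]
  · intro S S' _ _ h
    exact Finset.coe_injective h
  · rintro S ⟨_, hf, hn, hs⟩
    refine ⟨hf.toFinset, ⟨?_, ?_⟩, hf.coe_toFinset⟩
    · rw [← Set.ncard_eq_toFinset_card _ hf, hn]
    · apply Finset.coe_injective
      rw [Finset.coe_image, hf.coe_toFinset, hs]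

/-- The number `a(n)` of `n`-element subsets `S ⊆ ℙ²(k̄)` with `σ(S) = S`
satisfies `a(1) = q² + q + 1`, `a(2) = q⁴ + q³ + q²`,
`a(3) = q⁶ + q⁵ + q⁴ − q² − q` and
`a(n) = (q⁶ + q⁵ + q⁴ − q² − q − 1) q^{2n−6}` for `n ≥ 4`. -/
theorem stmt6 (k : Type*) [Field k] [Fintype k] (q : ℕ)
    (hq : Fintype.card k = q) :
    nSetCount (projFrob k 3) Set.univ 1 = q ^ 2 + q + 1 ∧
    nSetCount (projFrob k 3) Set.univ 2 = q ^ 4 + q ^ 3 + q ^ 2 ∧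
    nSetCount (projFrob k 3) Set.univ 3 = q ^ 6 + q ^ 5 + q ^ 4 - q ^ 2 - q ∧
    ∀ n : ℕ, 4 ≤ n →
      nSetCount (projFrob k 3) Set.univ n =
        (q ^ 6 + q ^ 5 + q ^ 4 - q ^ 2 - q - 1) * q ^ (2 * n - 6) := by
  classical
  have hinj := projFrob_inj6 k
  have hfin : ∀ j, 0 < j → {x | (projFrob k 3)^[j] x = x}.Finite := fun j hj => (proj_fix6 k j hj).1
  set a : ℕ → ℤ := fun n => ((T6 (projFrob k 3) n).ncard : ℤ) with ha
  set c : ℕ → ℤ := fun j => if j = 0 then 0 else (1 + (q:ℤ) ^ j + (q:ℤ) ^ (2 * j)) -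
      2 * (if 2 ∣ j then (1 + (q:ℤ) ^ (j/2) + (q:ℤ) ^ (2 * (j/2))) else 0) with hc
  have hc0 : c 0 = 0 := by simp [hc]
  have hcj : ∀ j, 0 < j → c j = (1 + (q:ℤ) ^ j + (q:ℤ) ^ (2 * j)) -
      2 * (if 2 ∣ j then (1 + (q:ℤ) ^ (j/2) + (q:ℤ) ^ (2 * (j/2))) else 0) := by
    intro j hj
    simp [hc, hj.ne']
  have hN : ∀ j, 0 < j → ({x | (projFrob k 3)^[j] x = x}.ncard : ℤ) =
      1 + (q:ℤ) ^ j + (q:ℤ) ^ (2 * j) := by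
    intro j hj
    rw [(proj_fix6 k j hj).2, hq]
    push_cast
    ring
  have ha0 : a 0 = 1 := by
    have : T6 (projFrob k 3) 0 = {∅} := by
      ext S
      simp only [T6, Set.mem_ofPred_eq, Set.mem_singleton_iff, Finset.card_eq_zero]
      constructor
      · exact fun h => h.1
      · rintro rfl
        exact ⟨rfl, rfl⟩
    simp [ha, this]
  have hrec := main_rec6 hinj hfin c hc0 (by
    intro j hj
    rw [hcj j hj, hN j hj]
    split_ifs with h2
    · rw [hN (j / 2) (by omega)]
    · rfl)
  obtain ⟨r1, r2, r3, r4⟩ := closed6 q a (series6 q a c ha0 hc0 hcj hrec)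
  have hq1 : 1 ≤ q := by rw [← hq]; exact Fintype.card_pos
  have e5 : q ≤ q ^ 5 := Nat.le_self_pow (by norm_num) q
  have e6 : 1 ≤ q ^ 6 := Nat.one_le_pow _ _ hq1
  have e4 : q ^ 2 ≤ q ^ 4 := Nat.pow_le_pow_right hq1 (by norm_num)
  simp only [nSet_eq6]
  refine ⟨?_, ?_, ?_, ?_⟩
  · zify
    exact r1
  · zify
    exact r2
  · zify [show q ^ 2 ≤ q ^ 6 + q ^ 5 + q ^ 4 by omega,
      show q ≤ q ^ 6 + q ^ 5 + q ^ 4 - q ^ 2 by omega]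
    exact r3
  · intro n hn
    obtain ⟨m, rfl⟩ := Nat.exists_eq_add_of_le' hn
    rw [show 2 * (m + 4) - 6 = 2 * m + 2 by omega]
    zify [show q ^ 2 ≤ q ^ 6 + q ^ 5 + q ^ 4 by omega,
      show q ≤ q ^ 6 + q ^ 5 + q ^ 4 - q ^ 2 by omega,
      show 1 ≤ q ^ 6 + q ^ 5 + q ^ 4 - q ^ 2 - q by omega]
    exact r4 m
end
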